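/- arXiv:math/9804044 — 11 statements merged into one kernel-verified Lean document; each statement's English description precedes it below -/
import Mathlib

section
/- Let D be a set in a real Banach space X. If D is an absolutely representing system, then there exists a constant c > 0 such that D is a c-ARS, i.e. every x ∈ X admits a representation x = ∑_{i=1}^∞ a_i x_i with (x_i) ⊂ D and ∑_{i=1}^∞ ‖a_i x_i‖ ≤ c‖x‖. -/
open scoped BigOperators

/-- `D` is a `c`-absolutely representing system in `X`: every `x` admits a representation
`x = ∑ aᵢ xᵢ` with `(xᵢ) ⊂ D` and `∑ ‖aᵢ xᵢ‖ ≤ c‖x‖`. -/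
def IsARS {X : Type*} [NormedAddCommGroup X] [NormedSpace ℝ X] (c : ℝ) (D : Set X) : Prop :=
  ∀ x : X, ∃ (a : ℕ → ℝ) (v : ℕ → X), (∀ i, v i ∈ D) ∧
    Summable (fun i => ‖a i • v i‖) ∧
    HasSum (fun i => a i • v i) x ∧
    ∑' i, ‖a i • v i‖ ≤ c * ‖x‖

/-- An absolutely convergent family `∑ b d • d` indexed by a nonempty set `D` can be rewritten as a
sequence of multiples of elements of `D`, with the same sum and the same sum of norms. -/
theorem exists_seq_of_hasSum_smul {X : Type*} [NormedAddCommGroup X] [NormedSpace ℝ X]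
    {D : Set X} (hD : D.Nonempty) {b : D → ℝ} {x : X} {s : ℝ} (hb : b.support.Countable)
    (hx : HasSum (fun d : D => b d • (d : X)) x) (hs : HasSum (fun d : D => ‖b d • (d : X)‖) s) :
    ∃ (a : ℕ → ℝ) (v : ℕ → X), (∀ i, v i ∈ D) ∧
      HasSum (fun i => ‖a i • v i‖) s ∧ HasSum (fun i => a i • v i) x := by
  obtain ⟨d₀, hd₀⟩ := hD
  obtain ⟨f, hf⟩ := Set.countable_iff_exists_injective.mp hb
  let a : ℕ → ℝ := Function.extend f (fun d => b d) 0
  let v : ℕ → X := Function.extend f (fun d => ((d : D) : X)) (fun _ => d₀)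
  have hav : (fun i => a i • v i) = Function.extend f (fun d => b d • ((d : D) : X)) 0 := by
    funext n
    by_cases hn : ∃ d, f d = n
    · obtain ⟨d, rfl⟩ := hn
      simp [a, v, hf.extend_apply]
    · simp [a, Function.extend_apply' _ _ _ hn]
  have hnorm : (fun i => ‖a i • v i‖) =
      Function.extend f (fun d => ‖b d • ((d : D) : X)‖) 0 := by
    funext n
    rw [congrFun hav n]
    by_cases hn : ∃ d, f d = n
    · obtain ⟨d, rfl⟩ := hn
      simp [hf.extend_apply]
    · simp [Function.extend_apply' _ _ _ hn]
  refine ⟨a, v, fun n => ?_, ?_, ?_⟩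
  · by_cases hn : ∃ d, f d = n
    · obtain ⟨d, rfl⟩ := hn
      simp [v, hf.extend_apply]
    · simpa [v, Function.extend_apply' _ _ _ hn] using hd₀
  · rw [hnorm, hasSum_extend_zero hf]
    refine (hasSum_subtype_iff_of_support_subset (s := b.support) ?_).mpr hs
    intro d hd hbd
    exact hd (by simp [hbd])
  · rw [hav, hasSum_extend_zero hf]
    refine (hasSum_subtype_iff_of_support_subset (s := b.support) ?_).mpr hx
    intro d hd hbd
    exact hd (by simp [hbd])

theorem lp.hasSum_norm_one {ι : Type*} (b : lp (fun _ : ι => ℝ) 1) :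
    HasSum (fun i => ‖b i‖) ‖b‖ := by
  simpa using lp.hasSum_norm (p := 1) (by simp) b

theorem norm_smul_inv_norm_smul_le {X : Type*} [NormedAddCommGroup X] [NormedSpace ℝ X]
    (r : ℝ) (x : X) : ‖(r * ‖x‖⁻¹) • x‖ ≤ ‖r‖ := by
  rw [norm_smul, norm_mul, norm_inv, norm_norm, mul_assoc]
  exact mul_le_of_le_one_right (norm_nonneg r) inv_mul_le_one

theorem lp.summable_norm_smul_normalized {X : Type*} [NormedAddCommGroup X] [NormedSpace ℝ X]
    {D : Set X} (b : lp (fun _ : D => ℝ) 1) :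
    Summable (fun d : D => ‖(b d * ‖(d : X)‖⁻¹) • (d : X)‖) :=
  (lp.hasSum_norm_one b).summable.of_nonneg_of_le (fun _ => norm_nonneg _)
    fun d => norm_smul_inv_norm_smul_le (b d) (d : X)

/-- The synthesis operator `ℓ¹(D) → X`, sending `b` to `∑ b d • (d / ‖d‖)`. -/
noncomputable def synthesis {X : Type*} [NormedAddCommGroup X] [NormedSpace ℝ X] [CompleteSpace X]
    (D : Set X) : lp (fun _ : D => ℝ) 1 →L[ℝ] X :=
  LinearMap.mkContinuous
    { toFun := fun b => ∑' d : D, (b d * ‖(d : X)‖⁻¹) • (d : X)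
      map_add' := fun b b' => by
        rw [← (lp.summable_norm_smul_normalized b).of_norm.tsum_add
          (lp.summable_norm_smul_normalized b').of_norm]
        simp [add_mul, add_smul]
      map_smul' := fun r b => by
        rw [RingHom.id_apply, ← (lp.summable_norm_smul_normalized b).of_norm.tsum_const_smul r]
        simp [mul_assoc, mul_smul] } 1 fun b => by
    rw [one_mul]
    exact tsum_of_norm_bounded (lp.hasSum_norm_one b)
      fun d => norm_smul_inv_norm_smul_le (b d) (d : X)

theorem hasSum_synthesis {X : Type*} [NormedAddCommGroup X] [NormedSpace ℝ X] [CompleteSpace X]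
    {D : Set X} (b : lp (fun _ : D => ℝ) 1) :
    HasSum (fun d : D => (b d * ‖(d : X)‖⁻¹) • (d : X)) (synthesis D b) :=
  (lp.summable_norm_smul_normalized b).of_norm.hasSum

theorem synthesis_single {X : Type*} [NormedAddCommGroup X] [NormedSpace ℝ X] [CompleteSpace X]
    {D : Set X} [DecidableEq D] (d : D) (r : ℝ) :
    synthesis D (lp.single 1 d r) = (r * ‖(d : X)‖⁻¹) • (d : X) := by
  refine (hasSum_synthesis _).unique ?_
  convert hasSum_single d ?_ using 1
  · simp
  · intro d' hd'
    simp [hd']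

theorem synthesis_surjective {X : Type*} [NormedAddCommGroup X] [NormedSpace ℝ X]
    [CompleteSpace X] {D : Set X}
    (hARS : ∀ x : X, ∃ (a : ℕ → ℝ) (v : ℕ → X), (∀ i, v i ∈ D) ∧
      Summable (fun i => ‖a i • v i‖) ∧ HasSum (fun i => a i • v i) x) :
    Function.Surjective (synthesis D) := by
  classical
  intro x
  obtain ⟨a, v, hv, hs, hx⟩ := hARS x
  let e : ℕ → lp (fun _ : D => ℝ) 1 := fun i => lp.single 1 ⟨v i, hv i⟩ (a i * ‖v i‖)
  have he : Summable e := by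
    refine Summable.of_norm (hs.congr fun i => ?_)
    simp [e, lp.norm_single, norm_smul]
  refine ⟨∑' i, e i, ((synthesis D).hasSum he.hasSum).unique ?_⟩
  convert hx using 2 with i
  rw [synthesis_single]
  rcases eq_or_ne (v i) 0 with h | h
  · simp [h]
  · rw [mul_inv_cancel_right₀ (norm_ne_zero_iff.mpr h)]

/-- If `D` is an absolutely representing system, then `D` is a `c`-ARS for some `c > 0`. -/
theorem stmt0 {X : Type*} [NormedAddCommGroup X] [NormedSpace ℝ X] [CompleteSpace X]
    (D : Set X)
    (hARS : ∀ x : X, ∃ (a : ℕ → ℝ) (v : ℕ → X), (∀ i, v i ∈ D) ∧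
      Summable (fun i => ‖a i • v i‖) ∧ HasSum (fun i => a i • v i) x) :
    ∃ c > 0, IsARS c D := by
  have hD : D.Nonempty := by
    obtain ⟨a, v, hv, -⟩ := hARS 0
    exact ⟨v 0, hv 0⟩
  obtain ⟨c, hc, h⟩ := (synthesis D).exists_preimage_norm_le (synthesis_surjective hARS)
  refine ⟨c, hc, fun x => ?_⟩
  obtain ⟨b, rfl, hbc⟩ := h x
  have hsum := lp.summable_norm_smul_normalized b
  have hsupp : (fun d : D => b d * ‖(d : X)‖⁻¹).support.Countable := by
    refine (lp.hasSum_norm_one b).summable.countable_support.mono fun d hd => ?_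
    simpa using left_ne_zero_of_mul hd
  obtain ⟨a, v, hv, hs, hx⟩ := exists_seq_of_hasSum_smul hD hsupp (hasSum_synthesis b) hsum.hasSum
  refine ⟨a, v, hv, hs.summable, hx, ?_⟩
  rw [hs.tsum_eq]
  exact (hasSum_le (fun d => norm_smul_inv_norm_smul_le (b d) (d : X)) hsum.hasSum
    (lp.hasSum_norm_one b)).trans hbc
end

section
/- Let X be an n-dimensional real normed space, let D be a normalized c-ARS in X, and let c₁ > c > 0. Then there is a subset D₁ ⊆ D which is a c₁-ARS and whose cardinality satisfies |D₁| ≤ e^{a n}, where a = 2/(1/c − 1/c₁). -/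
open scoped BigOperators

section Separated

open Module MeasureTheory Metric Set
open scoped ENNReal Function

variable {E : Type*} [NormedAddCommGroup E] [NormedSpace ℝ E] [FiniteDimensional ℝ E]

/-- Volumetric bound on the size of an `ε`-separated set in the unit ball. -/
theorem card_le_of_separated_unitBall {ε : ℝ} (hε : 0 < ε) (s : Finset E)
    (hs : ∀ c ∈ s, ‖c‖ ≤ 1) (h : ∀ c ∈ s, ∀ d ∈ s, c ≠ d → ε ≤ ‖c - d‖) :
    (s.card : ℝ) ≤ (1 + 2 / ε) ^ finrank ℝ E := by
  borelize E
  let μ : Measure E := Measure.addHaar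
  have δpos : 0 < ε / 2 := by positivity
  have ρpos : 0 < 1 + ε / 2 := by positivity
  have D : Set.Pairwise (s : Set E) (Disjoint on fun c => ball (c : E) (ε / 2)) := by
    rintro c hc d hd hcd
    apply ball_disjoint_ball
    rw [dist_eq_norm, add_halves]
    exact h c hc d hd hcd
  have A_subset : (⋃ c ∈ s, ball (c : E) (ε / 2)) ⊆ ball (0 : E) (1 + ε / 2) := by
    refine iUnion₂_subset fun x hx => ?_
    apply ball_subset_ball'
    rw [dist_zero_right]
    linarith [hs x hx]
  have I :
    (s.card : ℝ≥0∞) * ENNReal.ofReal ((ε / 2) ^ finrank ℝ E) * μ (ball 0 1) ≤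
      ENNReal.ofReal ((1 + ε / 2) ^ finrank ℝ E) * μ (ball 0 1) :=
    calc
      (s.card : ℝ≥0∞) * ENNReal.ofReal ((ε / 2) ^ finrank ℝ E) * μ (ball 0 1)
          = μ (⋃ c ∈ s, ball (c : E) (ε / 2)) := by
        rw [measure_biUnion_finset D fun c _ => measurableSet_ball]
        simp only [μ.addHaar_ball_of_pos _ δpos]
        simp only [Finset.sum_const, nsmul_eq_mul, mul_assoc]
      _ ≤ μ (ball (0 : E) (1 + ε / 2)) := measure_mono A_subset
      _ = ENNReal.ofReal ((1 + ε / 2) ^ finrank ℝ E) * μ (ball 0 1) := by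
        simp only [μ.addHaar_ball_of_pos _ ρpos]
  have J : (s.card : ℝ≥0∞) * ENNReal.ofReal ((ε / 2) ^ finrank ℝ E) ≤
      ENNReal.ofReal ((1 + ε / 2) ^ finrank ℝ E) :=
    (ENNReal.mul_le_mul_iff_left (measure_ball_pos _ _ zero_lt_one).ne' measure_ball_lt_top.ne).1 I
  have K := ENNReal.toReal_le_of_le_ofReal (pow_nonneg ρpos.le _) J
  rw [ENNReal.toReal_mul, ENNReal.toReal_natCast, ENNReal.toReal_ofReal (by positivity)] at K
  have e : 1 + 2 / ε = (1 + ε / 2) / (ε / 2) := by field_simp; ring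
  rw [e, div_pow, le_div_iff₀ (by positivity)]
  exact K

/-- A subset of the unit ball has an internal `ε`-net of size at most `(1 + 2 / ε) ^ dim`. -/
theorem exists_net_unitBall {ε : ℝ} (hε : 0 < ε) {D : Set E} (hD : ∀ d ∈ D, ‖d‖ ≤ 1) :
    ∃ s : Finset E, (s : Set E) ⊆ D ∧ (∀ d ∈ D, ∃ e ∈ s, ‖d - e‖ ≤ ε) ∧
      (s.card : ℝ) ≤ (1 + 2 / ε) ^ finrank ℝ E := by
  classical
  let S : Set ℕ := {N | ∃ s : Finset E, (s : Set E) ⊆ D ∧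
    (∀ c ∈ s, ∀ d ∈ s, c ≠ d → ε ≤ ‖c - d‖) ∧ s.card = N}
  have hne : S.Nonempty := ⟨0, ∅, by simp⟩
  have hbdd : BddAbove S := by
    refine ⟨⌊(1 + 2 / ε) ^ finrank ℝ E⌋₊, ?_⟩
    rintro _ ⟨s, hsD, hs, rfl⟩
    exact Nat.le_floor (card_le_of_separated_unitBall hε s (fun c hc => hD c (hsD hc)) hs)
  obtain ⟨s, hsD, hs, hcard⟩ := Nat.sSup_mem hne hbdd
  refine ⟨s, hsD, fun d hd => ?_,
    card_le_of_separated_unitBall hε s (fun c hc => hD c (hsD hc)) hs⟩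
  by_contra! hfar
  have hds : d ∉ s := fun h => by
    have := hfar d h
    simp at this
    linarith
  have hmem : (insert d s).card ∈ S := by
    refine ⟨insert d s, ?_, ?_, rfl⟩
    · rw [Finset.coe_insert]
      exact Set.insert_subset hd hsD
    · intro x hx y hy hxy
      rw [Finset.mem_insert] at hx hy
      rcases hx with rfl | hx <;> rcases hy with rfl | hy
      · exact absurd rfl hxy
      · exact (hfar y hy).le
      · rw [norm_sub_rev]
        exact (hfar x hx).le
      · exact hs x hx y hy hxy
  have := le_csSup hbdd hmem
  rw [Finset.card_insert_of_notMem hds, hcard] at this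
  omega

end Separated

section ARS

variable {X : Type*} [NormedAddCommGroup X] [NormedSpace ℝ X]

theorem IsARS.nonempty {c : ℝ} {D : Set X} (h : IsARS c D) : D.Nonempty := by
  obtain ⟨_, v, hv, -⟩ := h 0
  exact ⟨v 0, hv 0⟩

/-- A functional bounded by `M` on a normalized `c`-ARS has norm at most `c * M`. -/
theorem IsARS.norm_le {c : ℝ} (hc : 0 ≤ c) {D : Set X} (h : IsARS c D) (hD : ∀ d ∈ D, ‖d‖ = 1)
    (f : StrongDual ℝ X) {M : ℝ} (hM : ∀ d ∈ D, |f d| ≤ M) : ‖f‖ ≤ c * M := by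
  have hM0 : 0 ≤ M := by
    obtain ⟨d, hd⟩ := h.nonempty
    exact (abs_nonneg _).trans (hM d hd)
  refine f.opNorm_le_bound (by positivity) fun x => ?_
  obtain ⟨a, v, hv, hsum, hx, hle⟩ := h x
  have key : ‖f x‖ ≤ M * ∑' i, ‖a i • v i‖ := by
    rw [← (hx.mapL f).tsum_eq]
    refine tsum_of_norm_bounded (hsum.hasSum.mul_left M) fun i => ?_
    rw [map_smul, norm_smul, norm_smul, hD _ (hv i), mul_one, mul_comm]
    exact mul_le_mul_of_nonneg_right (hM _ (hv i)) (norm_nonneg _)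
  calc ‖f x‖ ≤ M * ∑' i, ‖a i • v i‖ := key
    _ ≤ M * (c * ‖x‖) := by gcongr
    _ = c * M * ‖x‖ := by ring

/-- If the symmetric convex hull of a nonempty normalized set contains the ball of
radius `1 / c`, the set is a `c`-ARS. -/
theorem isARS_of_ball_subset_convexHull {c : ℝ} (hc : 0 < c) {D : Set X} (hne : D.Nonempty)
    (hD : ∀ d ∈ D, ‖d‖ = 1)
    (h : ∀ y : X, ‖y‖ ≤ 1 / c → y ∈ convexHull ℝ (D ∪ Neg.neg '' D)) : IsARS c D := by
  intro x
  obtain ⟨d₀, hd₀⟩ := hne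
  set r : ℝ := c * ‖x‖ with hr
  have hr0 : 0 ≤ r := by positivity
  have hy : r⁻¹ • x ∈ convexHull ℝ (D ∪ Neg.neg '' D) := by
    apply h
    rcases eq_or_ne x 0 with rfl | hx
    · simp [hc.le]
    · have : ‖x‖ ≠ 0 := norm_ne_zero_iff.2 hx
      rw [norm_smul, norm_inv, Real.norm_of_nonneg hr0, hr]
      apply le_of_eq
      field_simp
  obtain ⟨ι, _, w, z, hw0, hw1, hz, hsum⟩ := mem_convexHull_iff_exists_fintype.1 hy
  have hσ : ∀ i, ∃ (t : ℝ) (d : X), |t| = 1 ∧ d ∈ D ∧ z i = t • d := by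
    intro i
    rcases hz i with hi | ⟨d, hd, hi⟩
    · exact ⟨1, z i, by simp, hi, by simp⟩
    · exact ⟨-1, d, by simp, hd, by simp [← hi]⟩
  choose t d ht hd hzd using hσ
  let e : ι → ℕ := fun i => (Fintype.equivFin ι i : ℕ)
  have he : Function.Injective e := Fin.val_injective.comp (Fintype.equivFin ι).injective
  let b : ι → ℝ := fun i => r * (w i * t i)
  have hext : (fun k => Function.extend e b 0 k • Function.extend e d (fun _ => d₀) k)
      = Function.extend e (fun i => b i • d i) 0 := by
    funext k
    by_cases hk : ∃ i, e i = k
    · obtain ⟨i, rfl⟩ := hk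
      simp [he.extend_apply]
    · simp [Function.extend_apply' _ _ _ hk]
  have hextn : (fun k => ‖Function.extend e b 0 k • Function.extend e d (fun _ => d₀) k‖)
      = Function.extend e (fun i => ‖b i • d i‖) 0 := by
    funext k
    rw [congrFun hext k]
    by_cases hk : ∃ i, e i = k
    · obtain ⟨i, rfl⟩ := hk
      simp [he.extend_apply]
    · simp [Function.extend_apply' _ _ _ hk]
  have hnorm : HasSum (Function.extend e (fun i => ‖b i • d i‖) 0) r := by
    rw [hasSum_extend_zero he]
    convert hasSum_fintype (fun i => ‖b i • d i‖) using 1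
    simp only [b, norm_smul, hD _ (hd _), mul_one, norm_mul, Real.norm_eq_abs, ht,
      abs_of_nonneg hr0, abs_of_nonneg (hw0 _)]
    rw [← Finset.mul_sum, hw1, mul_one]
  refine ⟨Function.extend e b 0, Function.extend e d (fun _ => d₀), fun k => ?_, ?_, ?_, ?_⟩
  · by_cases hk : ∃ i, e i = k
    · obtain ⟨i, rfl⟩ := hk
      rw [he.extend_apply]
      exact hd i
    · rwa [Function.extend_apply' _ _ _ hk]
  · rw [hextn]
    exact hnorm.summable
  · rw [hext, hasSum_extend_zero he]
    convert hasSum_fintype (fun i => b i • d i) using 1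
    have : ∑ i, b i • d i = r • ∑ i, w i • z i := by
      rw [Finset.smul_sum]
      exact Finset.sum_congr rfl fun i _ => by rw [hzd, smul_smul, smul_smul, mul_assoc]
    rw [this, hsum]
    rcases eq_or_ne x 0 with rfl | hx
    · simp
    · have : r ≠ 0 := (mul_pos hc (norm_pos_iff.2 hx)).ne'
      rw [smul_smul, mul_inv_cancel₀ this, one_smul]
  · rw [hextn, hnorm.tsum_eq]

/-- A finite subset that is a `(1 / c - 1 / c₁)`-net of a normalized `c`-ARS is a `c₁`-ARS. -/
theorem IsARS.of_finite_net {c c₁ : ℝ} (hc : 0 < c) (hc₁ : 0 < c₁) {D D₁ : Set X}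
    (h : IsARS c D) (hD : ∀ d ∈ D, ‖d‖ = 1) (hsub : D₁ ⊆ D) (hfin : D₁.Finite)
    (hnet : ∀ d ∈ D, ∃ e ∈ D₁, ‖d - e‖ ≤ 1 / c - 1 / c₁) : IsARS c₁ D₁ := by
  have hne : D₁.Nonempty := by
    obtain ⟨d, hd⟩ := h.nonempty
    obtain ⟨e, he, -⟩ := hnet d hd
    exact ⟨e, he⟩
  refine isARS_of_ball_subset_convexHull hc₁ hne (fun d hd => hD d (hsub hd)) fun y hy => ?_
  by_contra hmem
  obtain ⟨f, u, hf, hu⟩ := geometric_hahn_banach_closed_point (convex_convexHull ℝ _)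
    ((hfin.union (hfin.image _)).isCompact_convexHull ℝ).isClosed hmem
  have hfe : ∀ e ∈ D₁, |f e| ≤ u := fun e he => by
    have h1 := hf e (subset_convexHull ℝ _ (Or.inl he))
    have h2 := hf (-e) (subset_convexHull ℝ _ (Or.inr ⟨e, he, rfl⟩))
    rw [map_neg] at h2
    exact abs_le.2 ⟨by linarith, h1.le⟩
  have hfd : ∀ d ∈ D, |f d| ≤ u + ‖f‖ * (1 / c - 1 / c₁) := fun d hd => by
    obtain ⟨e, he, hde⟩ := hnet d hd
    have h1 : |f (d - e)| ≤ ‖f‖ * (1 / c - 1 / c₁) :=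
      (f.le_opNorm _).trans (mul_le_mul_of_nonneg_left hde (norm_nonneg _))
    have h2 : f d = f e + f (d - e) := by simp
    rw [h2]
    exact (abs_add_le _ _).trans (add_le_add (hfe e he) h1)
  have h1 := h.norm_le hc.le hD f hfd
  have h2 : ‖f‖ * (1 / c₁) ≤ u := by
    have h3 : c * (u + ‖f‖ * (1 / c - 1 / c₁)) = ‖f‖ + c * (u - ‖f‖ * (1 / c₁)) := by
      field_simp
      ring
    rw [h3] at h1
    have := nonneg_of_mul_nonneg_right (by linarith : 0 ≤ c * (u - ‖f‖ * (1 / c₁))) hc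
    linarith
  have h4 : f y ≤ ‖f‖ * (1 / c₁) :=
    (le_abs_self _).trans ((f.le_opNorm y).trans (mul_le_mul_of_nonneg_left hy (norm_nonneg _)))
  linarith

end ARS

/-- In an `n`-dimensional space, from a normalized `c`-ARS `D` one can extract a
`c₁`-ARS `D₁ ⊆ D` with `|D₁| ≤ e^{an}` where `a = 2/(1/c - 1/c₁)`. -/
theorem stmt5 {X : Type*} [NormedAddCommGroup X] [NormedSpace ℝ X] [FiniteDimensional ℝ X]
    (n : ℕ) (hn : Module.finrank ℝ X = n)
    (D : Set X) (hD : ∀ d ∈ D, ‖d‖ = 1)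
    (c c₁ : ℝ) (hc : 0 < c) (hcc₁ : c < c₁) (hARS : IsARS c D) :
    ∃ D₁ ⊆ D, D₁.Finite ∧ IsARS c₁ D₁ ∧
      (D₁.ncard : ℝ) ≤ Real.exp ((2 / (1 / c - 1 / c₁)) * n) := by
  have hε : 0 < 1 / c - 1 / c₁ := sub_pos.2 (one_div_lt_one_div_of_lt hc hcc₁)
  obtain ⟨s, hsD, hnet, hcard⟩ := exists_net_unitBall hε fun d hd => (hD d hd).le
  refine ⟨s, hsD, s.finite_toSet,
    hARS.of_finite_net hc (hc.trans hcc₁) hD hsD s.finite_toSet hnet, ?_⟩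
  rw [Set.ncard_coe_finset, mul_comm, Real.exp_nat_mul]
  rw [hn] at hcard
  refine hcard.trans (pow_le_pow_left₀ (by positivity) ?_ n)
  rw [add_comm]
  exact Real.add_one_le_exp _
end

section
/- Let X be an n-dimensional real normed space, let D be a c-ARS in X for some c > 0, and let ε > 0. Then every x ∈ X with ‖x‖ ≤ 1 can be represented as a finite sum x = ∑_{i=1}^n a_i x_i with real scalars a_i, elements x_i ∈ D, and ∑_{i=1}^n ‖a_i x_i‖ ≤ c + ε. -/
open scoped BigOperators

/-- One step of the conic Carathéodory reduction: a linear dependence allows dropping an index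
without increasing the linear cost `r`. -/
theorem exists_erase_conic_combination {ι X : Type*} [DecidableEq ι] [AddCommGroup X] [Module ℝ X]
    (u : ι → X) (r : ι → ℝ) (t : Finset ι) (w : ι → ℝ) (hw : ∀ i ∈ t, 0 ≤ w i)
    (g : ι → ℝ) (hg : ∑ i ∈ t, g i • u i = 0) (hr : 0 ≤ ∑ i ∈ t, g i * r i)
    (hpos : ∃ i ∈ t, 0 < g i) :
    ∃ j ∈ t, ∃ w' : ι → ℝ, (∀ i ∈ t.erase j, 0 ≤ w' i) ∧
      ∑ i ∈ t.erase j, w' i • u i = ∑ i ∈ t, w i • u i ∧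
      ∑ i ∈ t.erase j, w' i * r i ≤ ∑ i ∈ t, w i * r i := by
  obtain ⟨i₀, hi₀, hgi₀⟩ := hpos
  obtain ⟨j, hj, hmin⟩ := (t.filter (fun i => 0 < g i)).exists_min_image (fun i => w i / g i)
    ⟨i₀, Finset.mem_filter.2 ⟨hi₀, hgi₀⟩⟩
  obtain ⟨hjt, hgj⟩ := Finset.mem_filter.1 hj
  have hl : 0 ≤ w j / g j := div_nonneg (hw j hjt) hgj.le
  have hz : w j - w j / g j * g j = 0 := by
    rw [div_mul_cancel₀ _ hgj.ne', sub_self]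
  refine ⟨j, hjt, fun i => w i - w j / g j * g i, fun i hi => ?_, ?_, ?_⟩
  · have hit := Finset.mem_of_mem_erase hi
    rcases le_or_gt (g i) 0 with h | h
    · nlinarith [hw i hit, mul_nonneg hl (neg_nonneg.2 h)]
    · have := hmin i (Finset.mem_filter.2 ⟨hit, h⟩)
      rw [le_div_iff₀ h] at this
      linarith
  · rw [Finset.sum_erase _ (by simp only [hz, zero_smul])]
    simp only [sub_smul, mul_smul, Finset.sum_sub_distrib, ← Finset.smul_sum, hg, smul_zero,
      sub_zero]
  · rw [Finset.sum_erase _ (by simp only [hz, zero_mul])]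
    simp only [sub_mul, mul_assoc, Finset.sum_sub_distrib, ← Finset.mul_sum]
    linarith [mul_nonneg hl hr]

/-- Among more than `finrank ℝ X` vectors there is a linear dependence with nonnegative cost and
some positive coefficient. -/
theorem exists_dependence_of_finrank_lt_card {ι X : Type*} [AddCommGroup X] [Module ℝ X]
    [FiniteDimensional ℝ X] (u : ι → X) (r : ι → ℝ) (t : Finset ι)
    (ht : Module.finrank ℝ X < t.card) (hr : ∀ i ∈ t, 0 ≤ r i) :
    ∃ g : ι → ℝ, ∑ i ∈ t, g i • u i = 0 ∧ 0 ≤ ∑ i ∈ t, g i * r i ∧ ∃ i ∈ t, 0 < g i := by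
  have hdep : ¬ LinearIndepOn ℝ u (t : Set ι) := fun h => by
    have := LinearIndependent.fintype_card_le_finrank h
    simp at this
    omega
  rw [linearIndepOn_finset_iff] at hdep
  push Not at hdep
  obtain ⟨g, hg, i, hi, hgi⟩ := hdep
  by_cases h : 0 ≤ ∑ i ∈ t, g i * r i ∧ ∃ i ∈ t, 0 < g i
  · exact ⟨g, hg, h⟩
  · refine ⟨-g, by simp [hg], ?_⟩
    simp only [Pi.neg_apply, neg_mul, Finset.sum_neg_distrib, Left.neg_pos_iff, Left.nonneg_neg_iff]
    by_cases hp : ∃ i ∈ t, 0 < g i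
    · have hs : ∑ i ∈ t, g i * r i < 0 := lt_of_not_ge fun h' => h ⟨h', hp⟩
      refine ⟨hs.le, ?_⟩
      by_contra! hn
      exact absurd (Finset.sum_nonneg fun i hi => mul_nonneg (hn i hi) (hr i hi)) hs.not_ge
    · push Not at hp
      exact ⟨Finset.sum_nonpos fun i hi => mul_nonpos_of_nonpos_of_nonneg (hp i hi) (hr i hi),
        i, hi, lt_of_le_of_ne (hp i hi) hgi⟩

/-- Conic Carathéodory theorem with a nonnegative linear cost. -/
theorem exists_conic_combination_card_le_finrank {ι X : Type*} [AddCommGroup X] [Module ℝ X]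
    [FiniteDimensional ℝ X] (u : ι → X) (r : ι → ℝ) (t : Finset ι) (hr : ∀ i ∈ t, 0 ≤ r i)
    (w : ι → ℝ) (hw : ∀ i ∈ t, 0 ≤ w i) :
    ∃ (s : Finset ι) (w' : ι → ℝ), s.card ≤ Module.finrank ℝ X ∧ (∀ i ∈ s, 0 ≤ w' i) ∧
      ∑ i ∈ s, w' i • u i = ∑ i ∈ t, w i • u i ∧
      ∑ i ∈ s, w' i * r i ≤ ∑ i ∈ t, w i * r i := by
  classical
  induction t using Finset.strongInduction generalizing w with
  | H t ih =>
    rcases le_or_gt t.card (Module.finrank ℝ X) with h | h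
    · exact ⟨t, w, h, hw, rfl, le_rfl⟩
    · obtain ⟨g, hg, hgr, hpos⟩ := exists_dependence_of_finrank_lt_card u r t h hr
      obtain ⟨j, hj, w₁, hw₁, hsum, hcost⟩ :=
        exists_erase_conic_combination u r t w hw g hg hgr hpos
      obtain ⟨s, w', hs, hw', hsum', hcost'⟩ := ih (t.erase j) (Finset.erase_ssubset hj)
        (fun i hi => hr i (Finset.mem_of_mem_erase hi)) w₁ hw₁
      exact ⟨s, w', hs, hw', hsum'.trans hsum, hcost'.trans hcost⟩

/-- A finite representation over `D` can be shortened to `finrank ℝ X` terms without increasing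
the sum of the norms. -/
theorem exists_fin_finrank_representation {ι X : Type*} [NormedAddCommGroup X] [NormedSpace ℝ X]
    [FiniteDimensional ℝ X] {D : Set X} (hD : D.Nonempty) (t : Finset ι) (a : ι → ℝ) (v : ι → X)
    (hv : ∀ i, v i ∈ D) :
    ∃ (a' : Fin (Module.finrank ℝ X) → ℝ) (v' : Fin (Module.finrank ℝ X) → X),
      (∀ i, v' i ∈ D) ∧ ∑ i, a' i • v' i = ∑ i ∈ t, a i • v i ∧
      ∑ i, ‖a' i • v' i‖ ≤ ∑ i ∈ t, ‖a i • v i‖ := by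
  obtain ⟨s, w, hs, hw, hsum, hcost⟩ := exists_conic_combination_card_le_finrank
    (fun i => a i • v i) (fun i => ‖a i • v i‖) t (fun i _ => norm_nonneg _) 1
    (fun _ _ => zero_le_one)
  obtain ⟨d, hd⟩ := hD
  obtain ⟨f⟩ : Nonempty (s ↪ Fin (Module.finrank ℝ X)) :=
    Function.Embedding.nonempty_of_card_le (by simpa using hs)
  let a' := Function.extend f (fun i : s => w i * a i) 0
  let v' := Function.extend f (fun i : s => v i) (fun _ => d)
  have ha' (i : s) : a' (f i) = w i * a i := f.injective.extend_apply _ _ _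
  have hv' (i : s) : v' (f i) = v i := f.injective.extend_apply _ _ _
  have ha0 (j) (hj : j ∉ Set.range f) : a' j = 0 := Function.extend_apply' _ _ _ hj
  have hsum_eq : ∑ i : s, (w i * a i) • v i = ∑ j, a' j • v' j :=
    Fintype.sum_of_injective f f.injective _ _ (fun j hj => by rw [ha0 j hj, zero_smul])
      (fun i => by rw [ha', hv'])
  have hnorm_eq : ∑ i : s, ‖(w i * a i) • v i‖ = ∑ j, ‖a' j • v' j‖ :=
    Fintype.sum_of_injective f f.injective _ _
      (fun j hj => by rw [ha0 j hj, zero_smul, norm_zero]) (fun i => by rw [ha', hv'])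
  refine ⟨a', v', fun j => ?_, ?_, ?_⟩
  · by_cases hj : j ∈ Set.range f
    · obtain ⟨i, rfl⟩ := hj
      rw [hv']
      exact hv i
    · rw [show v' j = d from Function.extend_apply' _ _ _ hj]
      exact hd
  · rw [← hsum_eq, Finset.sum_coe_sort s (fun i => (w i * a i) • v i)]
    simpa [mul_smul] using hsum
  · rw [← hnorm_eq, Finset.sum_coe_sort s (fun i => ‖(w i * a i) • v i‖)]
    refine le_trans (Finset.sum_le_sum fun i hi => ?_) (hcost.trans_eq (by simp))
    rw [mul_smul, norm_smul, Real.norm_of_nonneg (hw i hi)]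

/-- A `c`-ARS in a finite-dimensional space is a spanning set. -/
theorem IsARS.span_eq_top {X : Type*} [NormedAddCommGroup X] [NormedSpace ℝ X]
    [FiniteDimensional ℝ X] {c : ℝ} {D : Set X} (h : IsARS c D) : Submodule.span ℝ D = ⊤ := by
  refine eq_top_iff.2 fun x _ => ?_
  obtain ⟨a, v, hv, -, hx, -⟩ := h x
  exact (Submodule.closed_of_finiteDimensional (Submodule.span ℝ D)).mem_of_tendsto hx
    (Filter.Eventually.of_forall fun s => Submodule.sum_mem _ fun i _ =>
      Submodule.smul_mem _ _ (Submodule.subset_span (hv i)))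

/-- In an `n`-dimensional space, if `D` is a `c`-ARS then every `x` in the unit ball can be
written as a sum of `n` terms `x = ∑_{i=1}^n aᵢ xᵢ` with `(xᵢ) ⊂ D` and
`∑ ‖aᵢ xᵢ‖ ≤ c + ε`. -/
theorem stmt6 {X : Type*} [NormedAddCommGroup X] [NormedSpace ℝ X] [FiniteDimensional ℝ X]
    (n : ℕ) (hn : Module.finrank ℝ X = n)
    (D : Set X) (c : ℝ) (hc : 0 < c) (hARS : IsARS c D) (ε : ℝ) (hε : 0 < ε) :
    ∀ x : X, ‖x‖ ≤ 1 → ∃ (a : Fin n → ℝ) (v : Fin n → X), (∀ i, v i ∈ D) ∧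
      x = ∑ i, a i • v i ∧ ∑ i, ‖a i • v i‖ ≤ c + ε := by
  intro x hx
  subst hn
  obtain ⟨a, v, hv, hsummable, hsum, hle⟩ := hARS x
  obtain ⟨B, hBD, hBspan, hBli⟩ := exists_linearIndependent ℝ D
  let b := Module.Basis.mk hBli (by
    rw [Subtype.range_coe, hBspan, hARS.span_eq_top])
  have hb (i : B) : b i ∈ D := by
    rw [Module.Basis.mk_apply]
    exact hBD i.2
  have : Fintype B := Module.Basis.fintypeIndexOfRankLtAleph0 b (Module.rank_lt_aleph0 ℝ X)
  have hcont : Continuous fun y : X => ∑ i, ‖b.coord i y • b i‖ :=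
    continuous_finsetSum _ fun i _ =>
      (((b.coord i).continuous_of_finiteDimensional).smul continuous_const).norm
  have htend : Filter.Tendsto (fun s : Finset ℕ => x - ∑ i ∈ s, a i • v i) Filter.atTop
      (nhds 0) := by
    simpa using hsum.const_sub x
  have hcost := (hcont.tendsto 0).comp htend
  simp only [map_zero, zero_smul, norm_zero, Finset.sum_const_zero] at hcost
  obtain ⟨s, hs⟩ := (hcost.eventually_lt_const hε).exists
  obtain ⟨a', v', hv', hsum', hcost'⟩ := exists_fin_finrank_representation ⟨v 0, hv 0⟩
    (s.disjSum Finset.univ) (Sum.elim a fun i => b.coord i (x - ∑ i ∈ s, a i • v i))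
    (Sum.elim v b) (by rintro (i | i) <;> simp [hv, hb])
  refine ⟨a', v', hv', ?_, hcost'.trans ?_⟩
  · rw [hsum', Finset.sum_disjSum]
    simp only [Sum.elim_inl, Sum.elim_inr, Module.Basis.coord_apply, b.sum_repr]
    abel
  · rw [Finset.sum_disjSum]
    have h₁ : ∑ i ∈ s, ‖a i • v i‖ ≤ ∑' i, ‖a i • v i‖ :=
      hsummable.sum_le_tsum s fun i _ => norm_nonneg _
    have h₂ : c * ‖x‖ ≤ c := mul_le_of_le_one_right hc.le hx
    exact add_le_add (h₁.trans (hle.trans h₂)) hs.le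
end

section
/- Let D be a normalized set in a real Banach space X, let ε ∈ (0,1), b > 0, and let m be a positive integer. Suppose that for every x ∈ X with ‖x‖ ≤ 1 there exist elements x₁, …, x_m ∈ D and real scalars a₁, …, a_m with ∑_{i=1}^m |a_i| ≤ b and ‖x − ∑_{i=1}^m a_i x_i‖ ≤ ε. Then D is a (c,q)-quick representing system with c = b/ε and q = ε^{1/m}. -/
open scoped BigOperators

/-- `D` is a `(c,q)`-quick representing system in `X` (index `i : ℕ` starts at `0`,
so the bound reads `‖aᵢ xᵢ‖ ≤ c q^i`). -/
def IsQuickRS {X : Type*} [NormedAddCommGroup X] [NormedSpace ℝ X] (c q : ℝ) (D : Set X) :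
    Prop :=
  ∀ x : X, ‖x‖ ≤ 1 → ∃ (a : ℕ → ℝ) (v : ℕ → X), (∀ i, v i ∈ D) ∧
    HasSum (fun i => a i • v i) x ∧
    ∀ i, ‖a i • v i‖ ≤ c * q ^ i

/-- Rescaling the successive remainders of an `ε`-approximation `S` of the identity on the unit
ball expands each `x` in the ball as `∑ ε ^ k • S (u k)` with all `u k` in the ball. -/
lemma exists_tendsto_sum_of_approx {X : Type*} [NormedAddCommGroup X] [NormedSpace ℝ X]
    {ε : ℝ} (hε : 0 < ε) (hε1 : ε < 1) (S : X → X) (hS : ∀ x, ‖x‖ ≤ 1 → ‖x - S x‖ ≤ ε)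
    {x : X} (hx : ‖x‖ ≤ 1) :
    ∃ u : ℕ → X, (∀ k, ‖u k‖ ≤ 1) ∧
      Filter.Tendsto (fun n => ∑ k ∈ Finset.range n, ε ^ k • S (u k)) Filter.atTop (nhds x) := by
  let u : ℕ → X := fun k => (fun y => ε⁻¹ • (y - S y))^[k] x
  have hsucc (k : ℕ) : u (k + 1) = ε⁻¹ • (u k - S (u k)) := Function.iterate_succ_apply' _ _ _
  have hu (k : ℕ) : ‖u k‖ ≤ 1 := by
    induction k with
    | zero => exact hx
    | succ k ih =>
      rw [hsucc, norm_smul, Real.norm_of_nonneg (inv_pos.2 hε).le, inv_mul_le_iff₀ hε, mul_one]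
      exact hS _ ih
  have hpartial (n : ℕ) : ∑ k ∈ Finset.range n, ε ^ k • S (u k) = x - ε ^ n • u n := by
    induction n with
    | zero => simp [u]
    | succ n ih =>
      rw [Finset.sum_range_succ, ih, hsucc, smul_smul, pow_succ, mul_assoc,
        mul_inv_cancel₀ hε.ne', mul_one, smul_sub]
      abel
  refine ⟨u, hu, ?_⟩
  simp only [hpartial]
  have hrem : Filter.Tendsto (fun n => ε ^ n • u n) Filter.atTop (nhds 0) := by
    refine squeeze_zero_norm (fun n => ?_) (tendsto_pow_atTop_nhds_zero_of_lt_one hε.le hε1)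
    rw [norm_smul, Real.norm_of_nonneg (pow_pos hε n).le]
    exact mul_le_of_le_one_right (pow_pos hε n).le (hu n)
  simpa using tendsto_const_nhds.sub hrem

/-- Every power of `ε ^ (1/m)` whose exponent lies in the `i / m`-th block of length `m` is at
least `ε ^ (i / m + 1)`. -/
lemma pow_div_succ_le_rpow_inv_pow {ε : ℝ} (hε : 0 ≤ ε) (hε1 : ε ≤ 1) {m : ℕ} (hm : 0 < m)
    (i : ℕ) : ε ^ (i / m + 1) ≤ (ε ^ ((m : ℝ)⁻¹)) ^ i := by
  have hq : (ε ^ ((m : ℝ)⁻¹)) ^ m = ε := Real.rpow_inv_natCast_pow hε hm.ne'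
  calc ε ^ (i / m + 1) = (ε ^ ((m : ℝ)⁻¹)) ^ (m * (i / m + 1)) := by rw [pow_mul, hq]
    _ ≤ (ε ^ ((m : ℝ)⁻¹)) ^ i :=
      pow_le_pow_of_le_one (by positivity) (Real.rpow_le_one hε hε1 (by positivity))
        (Nat.lt_mul_div_succ i hm).le

/-- If every `x` in the unit ball is within `ε < 1` of an absolutely convex combination
`∑_{i=1}^m aᵢ xᵢ` with `xᵢ ∈ D`, `∑|aᵢ| ≤ b`, then the normalized set `D` is a
`(b/ε, ε^{1/m})`-quick representing system. -/
theorem stmt8 {X : Type*} [NormedAddCommGroup X] [NormedSpace ℝ X] [CompleteSpace X]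
    (D : Set X) (hD : ∀ d ∈ D, ‖d‖ = 1)
    (ε b : ℝ) (hε : ε ∈ Set.Ioo (0 : ℝ) 1) (hb : 0 < b) (m : ℕ) (hm : 0 < m)
    (hnet : ∀ x : X, ‖x‖ ≤ 1 →
      ∃ (a : Fin m → ℝ) (v : Fin m → X), (∀ i, v i ∈ D) ∧
        (∑ i, |a i|) ≤ b ∧ ‖x - ∑ i, a i • v i‖ ≤ ε) :
    IsQuickRS (b / ε) (ε ^ ((m : ℝ)⁻¹)) D := by
  obtain ⟨hε0, hε1⟩ := hε
  intro x hx
  have : NeZero m := ⟨hm.ne'⟩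
  choose! A V hVD hA happ using hnet
  obtain ⟨u, hu, hlim⟩ := exists_tendsto_sum_of_approx hε0 hε1 (fun y => ∑ j, A y j • V y j) happ hx
  let e := Nat.divModEquiv m
  let g : ℕ × Fin m → X := fun p => (ε ^ p.1 * A (u p.1) p.2) • V (u p.1) p.2
  have hbound (i : ℕ) : ‖g (e i)‖ ≤ b / ε * (ε ^ ((m : ℝ)⁻¹)) ^ i := by
    have hcoef : |A (u (e i).1) (e i).2| ≤ b :=
      (Finset.single_le_sum (f := fun j => |A (u (e i).1) j|) (fun _ _ => abs_nonneg _)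
        (Finset.mem_univ _)).trans (hA _ (hu _))
    calc ‖g (e i)‖ = ε ^ (i / m) * |A (u (e i).1) (e i).2| := by
          rw [norm_smul, hD _ (hVD _ (hu _) _), mul_one, norm_mul,
            Real.norm_of_nonneg (by positivity), Real.norm_eq_abs]
          rfl
      _ ≤ ε ^ (i / m) * b := by gcongr
      _ = b / ε * ε ^ (i / m + 1) := by rw [pow_succ]; field_simp
      _ ≤ b / ε * (ε ^ ((m : ℝ)⁻¹)) ^ i := by
          gcongr
          exact pow_div_succ_le_rpow_inv_pow hε0.le hε1.le hm i
  have hgeom : Summable fun i : ℕ => b / ε * (ε ^ ((m : ℝ)⁻¹)) ^ i :=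
    (summable_geometric_of_lt_one (by positivity)
      (Real.rpow_lt_one hε0.le hε1 (by positivity))).mul_left _
  have hg : Summable g := e.summable_iff.1 (Summable.of_norm_bounded hgeom hbound)
  have hblocks := (hg.hasSum.prod_fiberwise fun k => hasSum_fintype _).tendsto_sum_nat
  simp only [g, mul_smul, ← Finset.smul_sum] at hblocks
  have hsum : HasSum g x := by
    rw [tendsto_nhds_unique hlim hblocks]
    simpa only [g, mul_smul] using hg.hasSum
  exact ⟨fun i => ε ^ (e i).1 * A (u (e i).1) (e i).2, fun i => V (u (e i).1) (e i).2,
    fun i => hVD _ (hu _) _, e.hasSum_iff.2 hsum, hbound⟩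
end

section
/- Let (b_i)_{i≥1} be a sequence of real numbers with ∑_{i=1}^∞ |b_i| < ∞. Then there exist constants c > 0 and q ∈ (0,1), depending only on the sequence (b_i), such that for every real Banach space X, every (b_i)-representing system D in X is a (c,q)-quick representing system. -/
open scoped BigOperators

/-- `D` is a `(bᵢ)`-representing system in `X`: every `x` in the unit ball can be written as
`x = ∑ aᵢ xᵢ` with `(xᵢ) ⊂ D` and `‖aᵢ xᵢ‖ ≤ |bᵢ|` for all `i`. -/
def IsBRS {X : Type*} [NormedAddCommGroup X] [NormedSpace ℝ X] (b : ℕ → ℝ) (D : Set X) :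
    Prop :=
  ∀ x : X, ‖x‖ ≤ 1 → ∃ (a : ℕ → ℝ) (v : ℕ → X), (∀ i, v i ∈ D) ∧
    HasSum (fun i => a i • v i) x ∧
    ∀ i, ‖a i • v i‖ ≤ |b i|

open scoped Topology

lemma exists_pos_tsum_tail_le_half {f : ℕ → ℝ} : ∃ N : ℕ, 0 < N ∧ ∑' i, f (i + N) ≤ 1 / 2 := by
  have h := (tendsto_sum_nat_add f).eventually_le_const (show (0 : ℝ) < 1 / 2 by norm_num)
  obtain ⟨N, hN, hpos⟩ := (h.and (Filter.eventually_gt_atTop 0)).exists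
  exact ⟨N, hpos, hN⟩

/-- The terms of index at least `N` in a series dominated by `f` contribute at most the
corresponding tail of `∑ f`. -/
lemma HasSum.norm_sub_sum_range_le_tsum {X : Type*} [NormedAddCommGroup X] {g : ℕ → X} {x : X}
    {f : ℕ → ℝ} (hg : HasSum g x) (hf : Summable f) (hgf : ∀ i, ‖g i‖ ≤ f i) (N : ℕ) :
    ‖x - ∑ i ∈ Finset.range N, g i‖ ≤ ∑' i, f (i + N) := by
  have htail : HasSum (fun i => g (i + N)) (x - ∑ i ∈ Finset.range N, g i) :=
    (hasSum_nat_add_iff' N).2 hg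
  rw [← htail.tsum_eq]
  exact tsum_of_norm_bounded ((summable_nat_add_iff N).2 hf).hasSum fun i => hgf _

/-- Splitting off `N` terms at a time while halving the remainder yields a series converging
geometrically. -/
lemma IsQuickRS.of_approx {X : Type*} [NormedAddCommGroup X] [NormedSpace ℝ X] [CompleteSpace X]
    {D : Set X} {N : ℕ} {M q : ℝ} (hN : 0 < N) (hM : 0 ≤ M) (hq : q ∈ Set.Ioo (0 : ℝ) 1)
    (hqN : q ^ N = 1 / 2)
    (h : ∀ x : X, ‖x‖ ≤ 1 → ∃ (a : ℕ → ℝ) (v : ℕ → X), (∀ i, v i ∈ D) ∧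
      ‖x - ∑ i ∈ Finset.range N, a i • v i‖ ≤ 1 / 2 ∧ ∀ i, ‖a i • v i‖ ≤ M) :
    IsQuickRS (2 * M) q D := by
  intro x hx
  choose! a v hvD happrox hbound using h
  let y : ℕ → X := fun k =>
    (fun z => (2 : ℝ) • (z - ∑ i ∈ Finset.range N, a z i • v z i))^[k] x
  have hy_succ (k : ℕ) :
      y (k + 1) = (2 : ℝ) • (y k - ∑ i ∈ Finset.range N, a (y k) i • v (y k) i) := by
    simp only [y, Function.iterate_succ_apply']
  have hy (k : ℕ) : ‖y k‖ ≤ 1 := by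
    induction k with
    | zero => exact hx
    | succ k ih =>
      rw [hy_succ, norm_smul, Real.norm_two]
      linarith [happrox _ ih]
  let A : ℕ → ℝ := fun i => (1 / 2) ^ (i / N) * a (y (i / N)) (i % N)
  let V : ℕ → X := fun i => v (y (i / N)) (i % N)
  have hAV (i : ℕ) : ‖A i • V i‖ ≤ 2 * M * q ^ i := by
    have hmod : 1 / 2 ≤ q ^ (i % N) :=
      hqN ▸ pow_le_pow_of_le_one hq.1.le hq.2.le (Nat.mod_lt i hN).le
    have hpow : q ^ i = (1 / 2) ^ (i / N) * q ^ (i % N) := by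
      rw [← hqN, ← pow_mul, ← pow_add, Nat.div_add_mod]
    have hhalf : (0 : ℝ) ≤ (1 / 2) ^ (i / N) := by positivity
    calc ‖A i • V i‖
        = (1 / 2) ^ (i / N) * ‖a (y (i / N)) (i % N) • v (y (i / N)) (i % N)‖ := by
          simp only [A, V, mul_smul]
          rw [norm_smul, Real.norm_of_nonneg hhalf]
      _ ≤ (1 / 2) ^ (i / N) * M := by gcongr; exact hbound _ (hy _) _
      _ = 2 * M * ((1 / 2) ^ (i / N) * (1 / 2)) := by ring
      _ ≤ 2 * M * q ^ i := by rw [hpow]; gcongr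
  have hpartial (k : ℕ) :
      ∑ i ∈ Finset.range (k * N), A i • V i = x - ((1 / 2 : ℝ) ^ k) • y k := by
    induction k with
    | zero => simp [y]
    | succ k ih =>
      have hblock : ∑ j ∈ Finset.range N, A (k * N + j) • V (k * N + j) =
          ((1 / 2 : ℝ) ^ k) • ∑ j ∈ Finset.range N, a (y k) j • v (y k) j := by
        rw [Finset.smul_sum]
        refine Finset.sum_congr rfl fun j hj => ?_
        have hj' : j < N := Finset.mem_range.1 hj
        have hdiv : (k * N + j) / N = k := by
          rw [mul_comm, Nat.mul_add_div hN, Nat.div_eq_of_lt hj', add_zero]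
        have hmod : (k * N + j) % N = j := by
          rw [mul_comm, Nat.mul_add_mod, Nat.mod_eq_of_lt hj']
        simp only [A, V, hdiv, hmod, mul_smul]
      rw [add_mul, one_mul, Finset.sum_range_add, ih, hblock, hy_succ, smul_smul, pow_succ,
        mul_assoc, one_div_mul_cancel two_ne_zero, mul_one, smul_sub]
      abel
  have hsum : Summable fun i => A i • V i :=
    .of_norm_bounded ((summable_geometric_of_lt_one hq.1.le hq.2).mul_left _) hAV
  have hrem : Filter.Tendsto (fun k => ((1 / 2 : ℝ) ^ k) • y k) Filter.atTop (𝓝 0) := by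
    refine squeeze_zero_norm (fun k => ?_)
      (tendsto_pow_atTop_nhds_zero_of_lt_one (r := (1 / 2 : ℝ)) (by norm_num) (by norm_num))
    rw [norm_smul, Real.norm_of_nonneg (by positivity)]
    exact mul_le_of_le_one_right (by positivity) (hy k)
  have hlim : Filter.Tendsto (fun k => ∑ i ∈ Finset.range (k * N), A i • V i) Filter.atTop
      (𝓝 x) := by
    simpa only [hpartial, sub_zero] using hrem.const_sub x
  have hlim' := hsum.hasSum.tendsto_sum_nat.comp
    (Filter.tendsto_id.atTop_mul_const' (α := ℕ) hN)
  refine ⟨A, V, fun i => hvD _ (hy _) _, ?_, hAV⟩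
  rw [← tendsto_nhds_unique hlim' hlim]
  exact hsum.hasSum

/-- If `∑ |bᵢ| < ∞`, then there are `c > 0` and `q ∈ (0,1)`, depending only on `(bᵢ)`,
such that every `(bᵢ)`-representing system in any real Banach space is a `(c,q)`-quick
representing system. -/
theorem stmt9 (b : ℕ → ℝ) (hb : Summable fun i => |b i|) :
    ∃ c > (0 : ℝ), ∃ q ∈ Set.Ioo (0 : ℝ) 1,
      ∀ (X : Type*) [NormedAddCommGroup X] [NormedSpace ℝ X] [CompleteSpace X]
        (D : Set X), IsBRS b D → IsQuickRS c q D := by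
  obtain ⟨N, hN, htail⟩ := exists_pos_tsum_tail_le_half (f := fun i => |b i|)
  have hS : 0 ≤ ∑' i, |b i| := tsum_nonneg fun i => abs_nonneg _
  refine ⟨2 * (∑' i, |b i| + 1), by positivity, (1 / 2 : ℝ) ^ (N⁻¹ : ℝ),
    ⟨by positivity, Real.rpow_lt_one (by norm_num) (by norm_num) (by positivity)⟩, ?_⟩
  intro X _ _ _ D hD
  refine IsQuickRS.of_approx hN (by positivity)
    ⟨by positivity, Real.rpow_lt_one (by norm_num) (by norm_num) (by positivity)⟩
    (Real.rpow_inv_natCast_pow (by norm_num) hN.ne') fun x hx => ?_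
  obtain ⟨a, v, hv, hsum, hav⟩ := hD x hx
  refine ⟨a, v, hv, (hsum.norm_sub_sum_range_le_tsum hb hav N).trans htail, fun i => ?_⟩
  have hle : |b i| ≤ ∑' i, |b i| := hb.le_tsum i fun j _ => abs_nonneg _
  linarith [hav i]
end

section
/- Let D be a normalized (c,q)-quick representing system in a real Banach space X, with c > 0 and q ∈ (0,1). Then there exists a function f : X → ℝ such that: (a) (1−q)‖x‖ ≤ f(x) ≤ c‖x‖ for all x ∈ X; (b) f(t x) = |t| f(x) for all t ∈ ℝ and x ∈ X; (c) f(d) ≤ 1 for every d ∈ D; (d) for every x ∈ X with f(x) < 1 there exist real scalars (a_i) and elements (x_i) ⊂ D with x = ∑_{i=1}^∞ a_i x_i (converging in X), f(a_i x_i) ≤ q^{i-1} for all i ≥ 1, and f(x − a₁x₁) ≤ q. -/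
open scoped BigOperators

/-- `x` is the sum of a series `∑ aᵢ vᵢ` with `vᵢ ∈ D` and `|aᵢ| ≤ t qⁱ`. -/
def HasGeomRep {X : Type*} [NormedAddCommGroup X] [NormedSpace ℝ X] (D : Set X) (q t : ℝ)
    (x : X) : Prop :=
  ∃ (a : ℕ → ℝ) (v : ℕ → X), (∀ i, v i ∈ D) ∧ HasSum (fun i => a i • v i) x ∧
    ∀ i, |a i| ≤ t * q ^ i

/-- The least coefficient size in a geometric representation of `x` over `D`. -/
noncomputable def geomGauge {X : Type*} [NormedAddCommGroup X] [NormedSpace ℝ X] (D : Set X)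
    (q : ℝ) (x : X) : ℝ :=
  sInf {t | HasGeomRep D q t x}

section GeomGauge

variable {X : Type*} [NormedAddCommGroup X] [NormedSpace ℝ X] {D : Set X} {c q t : ℝ} {x : X}

theorem HasGeomRep.nonneg (h : HasGeomRep D q t x) : 0 ≤ t := by
  obtain ⟨a, v, -, -, ha⟩ := h
  simpa using (abs_nonneg _).trans (ha 0)

theorem HasGeomRep.mono {s : ℝ} (hq : 0 ≤ q) (h : HasGeomRep D q t x) (hts : t ≤ s) :
    HasGeomRep D q s x := by
  obtain ⟨a, v, hv, hx, ha⟩ := h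
  exact ⟨a, v, hv, hx, fun i => (ha i).trans (by gcongr)⟩

theorem HasGeomRep.smul (h : HasGeomRep D q t x) (r : ℝ) :
    HasGeomRep D q (|r| * t) (r • x) := by
  obtain ⟨a, v, hv, hx, ha⟩ := h
  refine ⟨fun i => r * a i, v, hv, by simpa only [mul_smul] using hx.const_smul r, fun i => ?_⟩
  rw [abs_mul, mul_assoc]
  exact mul_le_mul_of_nonneg_left (ha i) (abs_nonneg r)

theorem HasGeomRep.norm_le (hD : ∀ d ∈ D, ‖d‖ = 1) (hq : 0 ≤ q) (hq1 : q < 1)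
    (h : HasGeomRep D q t x) : (1 - q) * ‖x‖ ≤ t := by
  obtain ⟨a, v, hv, hx, ha⟩ := h
  have hsum := (hasSum_geometric_of_lt_one hq hq1).mul_left t
  have hle : ‖x‖ ≤ t * (1 - q)⁻¹ := by
    rw [← hx.tsum_eq]
    refine tsum_of_norm_bounded hsum fun i => ?_
    rw [norm_smul, hD _ (hv i), mul_one]
    exact ha i
  have hpos : 0 < 1 - q := sub_pos.2 hq1
  calc (1 - q) * ‖x‖ ≤ (1 - q) * (t * (1 - q)⁻¹) := by gcongr
    _ = t := by field_simp

theorem hasGeomRep_of_mem {d : X} (hq : 0 ≤ q) (hd : d ∈ D) : HasGeomRep D q 1 d := by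
  refine ⟨Pi.single 0 1, fun _ => d, fun _ => hd, ?_, fun i => ?_⟩
  · simpa using hasSum_single (f := fun i : ℕ => (Pi.single 0 1 : ℕ → ℝ) i • d) 0
      fun i hi => by simp [hi]
  · rcases eq_or_ne i 0 with rfl | hi
    · simp
    · simpa [hi] using pow_nonneg hq i

theorem IsQuickRS.hasGeomRep (hD : ∀ d ∈ D, ‖d‖ = 1) (h : IsQuickRS c q D) (x : X) :
    HasGeomRep D q (c * ‖x‖) x := by
  have key : ∀ y : X, ‖y‖ ≤ 1 → HasGeomRep D q c y := fun y hy => by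
    obtain ⟨a, v, hv, hs, ha⟩ := h y hy
    refine ⟨a, v, hv, hs, fun i => ?_⟩
    simpa [norm_smul, hD _ (hv i)] using ha i
  rcases eq_or_ne x 0 with rfl | hx
  · simpa using (key 0 (by simp)).smul 0
  · have hx' : ‖x‖ ≠ 0 := norm_ne_zero_iff.2 hx
    have := (key (‖x‖⁻¹ • x) (by simp [norm_smul, hx'])).smul ‖x‖
    rwa [smul_inv_smul₀ hx', abs_norm, mul_comm] at this

theorem HasGeomRep.geomGauge_le (h : HasGeomRep D q t x) : geomGauge D q x ≤ t :=
  csInf_le ⟨0, fun _ hs => HasGeomRep.nonneg hs⟩ h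

theorem geomGauge_nonneg : 0 ≤ geomGauge D q x :=
  Real.sInf_nonneg fun _ ht => HasGeomRep.nonneg ht

theorem geomGauge_smul_le (hne : ∀ x, ∃ t, HasGeomRep D q t x) (r : ℝ) (x : X) :
    geomGauge D q (r • x) ≤ |r| * geomGauge D q x := by
  rcases eq_or_ne r 0 with rfl | hr
  · obtain ⟨t, ht⟩ := hne x
    simpa using (ht.smul 0).geomGauge_le
  · rw [← div_le_iff₀' (abs_pos.2 hr)]
    refine le_csInf (hne x) fun t ht => ?_
    rw [div_le_iff₀' (abs_pos.2 hr)]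
    exact (HasGeomRep.smul ht r).geomGauge_le

theorem geomGauge_smul (hne : ∀ x, ∃ t, HasGeomRep D q t x) (r : ℝ) (x : X) :
    geomGauge D q (r • x) = |r| * geomGauge D q x := by
  refine (geomGauge_smul_le hne r x).antisymm ?_
  rcases eq_or_ne r 0 with rfl | hr
  · simpa using geomGauge_nonneg (D := D) (q := q) (x := (0 : X))
  · have := geomGauge_smul_le hne r⁻¹ (r • x)
    rwa [inv_smul_smul₀ hr, abs_inv, le_inv_mul_iff₀ (abs_pos.2 hr)] at this

end GeomGauge

/-- If `D` is a normalized `(c,q)`-quick RS in `X`, then there is an equivalent quasi-norm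
`f` with `(1-q)‖·‖ ≤ f ≤ c‖·‖`, homogeneous, with `D` inside its unit ball, in which `D`
is a `(1,q)`-quick RS and `⋃{tD : |t| ≤ c}` is a `q`-net of the unit ball. -/
theorem stmt13 {X : Type*} [NormedAddCommGroup X] [NormedSpace ℝ X] [CompleteSpace X]
    (D : Set X) (hD : ∀ d ∈ D, ‖d‖ = 1)
    (c q : ℝ) (hc : 0 < c) (hq : q ∈ Set.Ioo (0 : ℝ) 1) (hQRS : IsQuickRS c q D) :
    ∃ f : X → ℝ,
      (∀ x : X, (1 - q) * ‖x‖ ≤ f x ∧ f x ≤ c * ‖x‖) ∧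
      (∀ (t : ℝ) (x : X), f (t • x) = |t| * f x) ∧
      (∀ d ∈ D, f d ≤ 1) ∧
      (∀ x : X, f x < 1 → ∃ (a : ℕ → ℝ) (v : ℕ → X), (∀ i, v i ∈ D) ∧
        HasSum (fun i => a i • v i) x ∧
        (∀ i, f (a i • v i) ≤ q ^ i) ∧
        f (x - a 0 • v 0) ≤ q) := by
  obtain ⟨hq0, hq1⟩ := hq
  have hne : ∀ x, ∃ t, HasGeomRep D q t x := fun x => ⟨_, hQRS.hasGeomRep hD x⟩
  have hD1 : ∀ d ∈ D, geomGauge D q d ≤ 1 := fun d hd =>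
    (hasGeomRep_of_mem hq0.le hd).geomGauge_le
  refine ⟨geomGauge D q, fun x => ⟨le_csInf (hne x) fun t ht => ?_,
    (hQRS.hasGeomRep hD x).geomGauge_le⟩, geomGauge_smul hne, hD1, fun x hx => ?_⟩
  · exact HasGeomRep.norm_le hD hq0.le hq1 ht
  obtain ⟨t, ht, ht1⟩ := exists_lt_of_csInf_lt (hne x) hx
  obtain ⟨a, v, hv, hs, ha⟩ := HasGeomRep.mono hq0.le ht ht1.le
  simp only [one_mul] at ha
  refine ⟨a, v, hv, hs, fun i => ?_, HasGeomRep.geomGauge_le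
    ⟨fun i => a (i + 1), fun i => v (i + 1), fun i => hv _, ?_, fun i => ?_⟩⟩
  · rw [geomGauge_smul hne]
    exact (mul_le_of_le_one_right (abs_nonneg _) (hD1 _ (hv i))).trans (ha i)
  · simpa using (hasSum_nat_add_iff' 1).2 hs
  · simpa only [pow_succ'] using ha (i + 1)
end

section
/- Let X be a real Banach space, let D be a normalized set in X, and let c > 1. Suppose τ ∈ (0,1) satisfies ρ_X(τ)/τ ≤ 1/(4c), where ρ_X is the modulus of smoothness of X. If D is a c-ARS, then, setting t = 2τ/3 and ε = 1 − τ/(3c), the set { θ t d : θ ∈ {−1,1}, d ∈ D } is an ε-net of the closed unit ball B(X). -/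
open scoped BigOperators

/-- The modulus of smoothness of the space `X`:
`ρ(τ) = sup {(‖x+y‖+‖x-y‖)/2 - 1 : ‖x‖ = 1, ‖y‖ ≤ τ}`. -/
noncomputable def modSmooth (X : Type*) [NormedAddCommGroup X] [NormedSpace ℝ X]
    (τ : ℝ) : ℝ :=
  sSup {r : ℝ | ∃ x y : X, ‖x‖ = 1 ∧ ‖y‖ ≤ τ ∧ r = (‖x + y‖ + ‖x - y‖) / 2 - 1}

/-- The defining inequality of the modulus of smoothness. -/
theorem norm_add_add_norm_sub_le_modSmooth {X : Type*} [NormedAddCommGroup X] [NormedSpace ℝ X]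
    {τ : ℝ} {x y : X} (hx : ‖x‖ = 1) (hy : ‖y‖ ≤ τ) :
    ‖x + y‖ + ‖x - y‖ ≤ 2 * (1 + modSmooth X τ) := by
  have hbdd : BddAbove {r : ℝ | ∃ x y : X, ‖x‖ = 1 ∧ ‖y‖ ≤ τ ∧
      r = (‖x + y‖ + ‖x - y‖) / 2 - 1} := by
    refine ⟨τ, ?_⟩
    rintro r ⟨u, v, hu, hv, rfl⟩
    linarith [norm_add_le u v, norm_sub_le u v]
  have h : (‖x + y‖ + ‖x - y‖) / 2 - 1 ≤ modSmooth X τ :=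
    le_csSup hbdd ⟨x, y, hx, hy, rfl⟩
  linarith

/-- A normalized `c`-ARS contains, for each functional `f` with `f x = 1` at a unit vector `x`,
an element on which `|f|` is at least `1 / c`. -/
theorem IsARS.exists_one_div_le_abs {X : Type*} [NormedAddCommGroup X] [NormedSpace ℝ X]
    {D : Set X} (hD : ∀ d ∈ D, ‖d‖ = 1) {c : ℝ} (hc : 0 < c) (hARS : IsARS c D)
    {x : X} (hx : ‖x‖ = 1) (f : X →L[ℝ] ℝ) (hf : f x = 1) :
    ∃ d ∈ D, 1 / c ≤ |f d| := by
  obtain ⟨a, v, hv, hsum, hx_sum, hle⟩ := hARS x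
  by_contra! hlt
  simp only [norm_smul, fun i => hD _ (hv i), mul_one, Real.norm_eq_abs] at hsum hle
  rw [hx, mul_one] at hle
  have hfs : HasSum (fun i => a i * f (v i)) 1 := by
    simpa [hf] using f.hasSum hx_sum
  have hbound : ∀ i, a i * f (v i) ≤ |a i| * (1 / c) := fun i =>
    (le_abs_self _).trans <| by
      rw [abs_mul]
      exact mul_le_mul_of_nonneg_left (hlt _ (hv i)).le (abs_nonneg _)
  have hne : ∃ i, a i ≠ 0 := by
    by_contra! h
    simp only [h, zero_mul] at hfs
    exact one_ne_zero (hfs.unique hasSum_zero)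
  obtain ⟨i, hi⟩ := hne
  have hstrict : a i * f (v i) < |a i| * (1 / c) := by
    refine (le_abs_self _).trans_lt ?_
    rw [abs_mul]
    exact mul_lt_mul_of_pos_left (hlt _ (hv i)) (abs_pos.2 hi)
  have h1 : 1 < (∑' i, |a i|) * (1 / c) :=
    hasSum_lt hbound hstrict hfs (hsum.hasSum.mul_right _)
  have h2 : (∑' i, |a i|) * (1 / c) ≤ c * (1 / c) :=
    mul_le_mul_of_nonneg_right hle (by positivity)
  rw [mul_one_div_cancel hc.ne'] at h2
  linarith

/-- In a space with small modulus of smoothness, every unit vector is moved strictly inside the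
unit ball by subtracting a suitable signed multiple of an element of a normalized `c`-ARS. -/
theorem IsARS.exists_norm_sub_smul_le {X : Type*} [NormedAddCommGroup X] [NormedSpace ℝ X]
    {D : Set X} (hD : ∀ d ∈ D, ‖d‖ = 1) {c : ℝ} (hc : 0 < c) {τ : ℝ} (hτ : 0 < τ)
    (hsm : modSmooth X τ / τ ≤ 1 / (4 * c)) (hARS : IsARS c D) {x : X} (hx : ‖x‖ = 1) :
    ∃ θ : ℝ, (θ = 1 ∨ θ = -1) ∧ ∃ d ∈ D, ‖x - (θ * τ) • d‖ ≤ 1 - τ / (2 * c) := by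
  obtain ⟨f, hf_norm, hfx⟩ := exists_dual_vector ℝ x (by simp [hx])
  have hfx' : f x = 1 := by simpa [hx] using hfx
  obtain ⟨d, hd, hfd⟩ := hARS.exists_one_div_le_abs hD hc hx f hfx'
  obtain ⟨θ, hθ, hθf⟩ : ∃ θ : ℝ, (θ = 1 ∨ θ = -1) ∧ θ * f d = |f d| := by
    rcases abs_choice (f d) with h | h
    · exact ⟨1, Or.inl rfl, by rw [h, one_mul]⟩
    · exact ⟨-1, Or.inr rfl, by rw [h, neg_one_mul]⟩
  refine ⟨θ, hθ, d, hd, ?_⟩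
  have hy : ‖(θ * τ) • d‖ ≤ τ := by
    rcases hθ with rfl | rfl <;> simp [norm_smul, hD d hd, abs_of_pos hτ]
  have hlower : 1 + τ * (1 / c) ≤ ‖x + (θ * τ) • d‖ := by
    calc 1 + τ * (1 / c) ≤ 1 + τ * |f d| := by gcongr
      _ = f (x + (θ * τ) • d) := by
        rw [map_add, map_smul, hfx', smul_eq_mul, ← hθf]; ring
      _ ≤ ‖f (x + (θ * τ) • d)‖ := Real.le_norm_self _
      _ ≤ ‖x + (θ * τ) • d‖ := by
        simpa [hf_norm] using f.le_opNorm (x + (θ * τ) • d)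
  have hupper := norm_add_add_norm_sub_le_modSmooth hx hy
  have hρ : modSmooth X τ ≤ 1 / (4 * c) * τ := (div_le_iff₀ hτ).1 hsm
  have e1 : 1 / (4 * c) * τ = τ * (1 / c) / 4 := by field_simp
  have e2 : τ / (2 * c) = τ * (1 / c) / 2 := by field_simp
  linarith

/-- If `D` is a normalized `c`-ARS in a Banach space `X` with `ρ(τ)/τ ≤ 1/(4c)` for some
`τ ∈ (0,1)`, then the set `±(2τ/3)D` is a `(1 - τ/(3c))`-net of the unit ball. -/
theorem stmt14 {X : Type*} [NormedAddCommGroup X] [NormedSpace ℝ X] [CompleteSpace X]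
    (D : Set X) (hD : ∀ d ∈ D, ‖d‖ = 1) (c : ℝ) (hc : 1 < c)
    (τ : ℝ) (hτ : τ ∈ Set.Ioo (0 : ℝ) 1)
    (hsm : modSmooth X τ / τ ≤ 1 / (4 * c))
    (hARS : IsARS c D) :
    ∀ x : X, ‖x‖ ≤ 1 →
      ∃ (θ : ℝ), (θ = 1 ∨ θ = -1) ∧ ∃ d ∈ D, ‖x - (θ * (2 * τ / 3)) • d‖ ≤ 1 - τ / (3 * c) := by
  obtain ⟨hτ0, hτ1⟩ := hτ
  have hc0 : 0 < c := by linarith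
  intro x hx
  set q : ℝ := τ / c with hq
  have hq0 : 0 < q := div_pos hτ0 hc0
  have hqτ : q ≤ τ := div_le_self hτ0.le hc.le
  have e3 : τ / (3 * c) = q / 3 := by rw [hq]; field_simp
  have e2 : τ / (2 * c) = q / 2 := by rw [hq]; field_simp
  rw [e3]
  rcases eq_or_ne x 0 with rfl | hx0
  · obtain ⟨-, v, hv, -⟩ := hARS 0
    refine ⟨1, Or.inl rfl, v 0, hv 0, ?_⟩
    rw [zero_sub, norm_neg, norm_smul, hD _ (hv 0), Real.norm_of_nonneg (by positivity)]
    linarith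
  obtain ⟨u, hu, hxu⟩ : ∃ u : X, ‖u‖ = 1 ∧ x = ‖x‖ • u :=
    ⟨‖x‖⁻¹ • x, norm_smul_inv_norm hx0, by rw [smul_inv_smul₀ (norm_ne_zero_iff.2 hx0)]⟩
  obtain ⟨θ, hθ, d, hd, hle⟩ := hARS.exists_norm_sub_smul_le hD hc0 hτ0 hsm hu
  rw [e2] at hle
  refine ⟨θ, hθ, d, hd, ?_⟩
  have hθd : ‖θ • d‖ = 1 := by rcases hθ with rfl | rfl <;> simp [hD d hd]
  have hs0 : 0 ≤ ‖x‖ := norm_nonneg x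
  generalize ‖x‖ = s at hx hxu hs0
  subst hxu
  rcases le_total (2 / 3) s with hs | hs
  · have key : s • u - (θ * (2 * τ / 3)) • d
        = (s - 2 / 3) • u + (2 / 3 : ℝ) • (u - (θ * τ) • d) := by module
    rw [key]
    refine (norm_add_le _ _).trans ?_
    rw [norm_smul, norm_smul, hu, Real.norm_of_nonneg (by linarith : 0 ≤ s - 2 / 3),
      Real.norm_of_nonneg (by norm_num : (0 : ℝ) ≤ 2 / 3)]
    linarith
  · have key : s • u - (θ * (2 * τ / 3)) • d
        = s • (u - (θ * τ) • d) - ((2 / 3 - s) * τ) • (θ • d) := by module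
    rw [key]
    refine (norm_sub_le _ _).trans ?_
    rw [norm_smul, norm_smul, hθd, Real.norm_of_nonneg hs0,
      Real.norm_of_nonneg (mul_nonneg (by linarith) hτ0.le)]
    nlinarith [mul_le_mul_of_nonneg_left hle hs0, mul_nonneg hs0 hq0.le,
      mul_nonneg (sub_nonneg.2 hs) (sub_nonneg.2 hτ1.le)]
end

section
/- Let X be a nonzero real normed space, let τ > 0 and δ ∈ (0,1), and let A ⊂ X be a subset of τ·B(X) (i.e. ‖a‖ ≤ τ for all a ∈ A) which is a (1−δ)-net of the unit sphere S(X). Then for every γ with 0 ≤ γ ≤ min(1, 1/(τ+δ)), the set γA = {γa : a ∈ A} is a (1−γδ)-net of the closed unit ball B(X). -/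
open scoped BigOperators

/-- If `A ⊂ τ·B(X)` is a `(1-δ)`-net of the unit sphere `S(X)` of a nonzero normed space,
then for each `0 ≤ γ ≤ min(1, 1/(τ+δ))` the set `γA` is a `(1-γδ)`-net of the closed unit
ball `B(X)`. -/
theorem stmt15 {X : Type*} [NormedAddCommGroup X] [NormedSpace ℝ X] [Nontrivial X]
    (τ δ : ℝ) (hτ : 0 < τ) (hδ : δ ∈ Set.Ioo (0 : ℝ) 1)
    (A : Set X) (hA : ∀ a ∈ A, ‖a‖ ≤ τ)
    (hnet : ∀ x : X, ‖x‖ = 1 → ∃ y ∈ A, ‖x - y‖ ≤ 1 - δ) :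
    ∀ γ : ℝ, 0 ≤ γ → γ ≤ min 1 (1 / (τ + δ)) →
      ∀ x : X, ‖x‖ ≤ 1 → ∃ y ∈ A, ‖x - γ • y‖ ≤ 1 - γ * δ := by
  intro γ hγ0 hγ x hx
  obtain ⟨hδ0, hδ1⟩ := hδ
  have hγ1 : γ ≤ 1 := hγ.trans (min_le_left _ _)
  have hγτ : γ * (τ + δ) ≤ 1 :=
    (le_div_iff₀ (by positivity)).1 (hγ.trans (min_le_right _ _))
  obtain ⟨u, hu, hxu⟩ : ∃ u : X, ‖u‖ = 1 ∧ x = ‖x‖ • u := by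
    rcases eq_or_ne x 0 with rfl | h
    · obtain ⟨u, hu⟩ := exists_norm_eq X zero_le_one
      exact ⟨u, hu, by simp⟩
    · have h' : ‖x‖ ≠ 0 := norm_ne_zero_iff.2 h
      exact ⟨‖x‖⁻¹ • x, by simp [norm_smul, h'], by rw [smul_inv_smul₀ h']⟩
  obtain ⟨a, ha, hua⟩ := hnet u hu
  refine ⟨a, ha, ?_⟩
  have haτ := hA a ha
  have ht := norm_nonneg x
  generalize ‖x‖ = t at *
  subst hxu
  rcases le_total γ t with h | h
  · have key : ‖t • u - γ • a‖ ≤ (t - γ) * 1 + γ * (1 - δ) := calc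
      ‖t • u - γ • a‖ = ‖(t - γ) • u + γ • (u - a)‖ := by congr 1; module
      _ ≤ ‖(t - γ) • u‖ + ‖γ • (u - a)‖ := norm_add_le _ _
      _ = (t - γ) * ‖u‖ + γ * ‖u - a‖ := by
        rw [norm_smul_of_nonneg (sub_nonneg.2 h), norm_smul_of_nonneg hγ0]
      _ ≤ _ := by rw [hu]; gcongr
    linarith
  · have key : ‖t • u - γ • a‖ ≤ t * (1 - δ) + (γ - t) * τ := calc
      ‖t • u - γ • a‖ = ‖t • (u - a) - (γ - t) • a‖ := by congr 1; module
      _ ≤ ‖t • (u - a)‖ + ‖(γ - t) • a‖ := norm_sub_le _ _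
      _ = t * ‖u - a‖ + (γ - t) * ‖a‖ := by
        rw [norm_smul_of_nonneg ht, norm_smul_of_nonneg (sub_nonneg.2 h)]
      _ ≤ _ := by
        have := sub_nonneg.2 h
        gcongr
    rcases le_total (1 - δ) τ with h' | h'
    · linarith [mul_le_mul_of_nonneg_left h' ht]
    · linarith [mul_le_mul_of_nonneg_left h' (sub_nonneg.2 h)]
end

section
/- Let X be a real normed space, let x ∈ X with ‖x‖ = 1, and let x* be a continuous linear functional on X with ‖x*‖ = 1 and x*(x) = 1. Then for every z ∈ X one has x*(z) ≤ ‖z‖ ≤ x*(z) + 2ρ_X(‖z − x‖), where ρ_X is the modulus of smoothness of X. -/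
open scoped BigOperators

/-- If `‖x‖ = 1`, `‖x*‖ = 1` and `x*(x) = 1`, then for every `z` one has
`x*(z) ≤ ‖z‖ ≤ x*(z) + 2ρ(‖z - x‖)`. -/
theorem stmt16 {X : Type*} [NormedAddCommGroup X] [NormedSpace ℝ X]
    (x : X) (hx : ‖x‖ = 1) (f : X →L[ℝ] ℝ) (hf : ‖f‖ = 1) (hfx : f x = 1) :
    ∀ z : X, f z ≤ ‖z‖ ∧ ‖z‖ ≤ f z + 2 * modSmooth X (‖z - x‖) := by
  have hle : ∀ w : X, f w ≤ ‖w‖ := fun w => by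
    simpa [hf] using (Real.le_norm_self (f w)).trans (f.le_opNorm w)
  intro z
  refine ⟨hle z, ?_⟩
  have hρ : (‖x + (z - x)‖ + ‖x - (z - x)‖) / 2 - 1 ≤ modSmooth X ‖z - x‖ := by
    refine le_csSup ⟨‖z - x‖, ?_⟩ ⟨x, z - x, hx, le_rfl, rfl⟩
    rintro _ ⟨u, v, hu, hv, rfl⟩
    linarith [norm_add_le u v, norm_sub_le u v]
  have hz : x + (z - x) = z := by abel
  have hdual := hle (x - (z - x))
  rw [map_sub, map_sub, hfx] at hdual
  rw [hz] at hρ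
  linarith
end

section
/- Let p > 1, T > 0, and let X be a real Banach space which has type p with constant at most T. Let D be a nonempty normalized c-ARS in X with c > 1, and let k be a positive integer. Then the set { (c/k) ∑_{i=1}^k θ_i x_i : θ_i ∈ {−1,1}, x_i ∈ D } is an ε-net of the closed unit ball B(X), where ε = 4 c T k^{−1/p*} and p* is the conjugate exponent, 1/p + 1/p* = 1. -/
open scoped BigOperators

/-- `X` has (Rademacher) type `p` with constant at most `T`: for every finite sequence
`x₁, …, x_k` in `X`, the average over all sign vectors `θ ∈ {-1,1}^k` of
`‖∑ θᵢ xᵢ‖^p` is at most `T^p ∑ ‖xᵢ‖^p`. -/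
def HasTypeLe (X : Type*) [NormedAddCommGroup X] [NormedSpace ℝ X] (p T : ℝ) : Prop :=
  ∀ (k : ℕ) (v : Fin k → X),
    (∑ θ : Fin k → Bool, ‖∑ i, (if θ i then (1 : ℝ) else -1) • v i‖ ^ p) / 2 ^ k
      ≤ T ^ p * ∑ i, ‖v i‖ ^ p

lemma sum_pi_prod_weight {ι : Type*} [Fintype ι] (w : ι → ℝ) (hw : ∑ j, w j = 1) (k : ℕ) :
    ∑ f : Fin k → ι, ∏ i, w (f i) = 1 := by
  classical
  have h := Finset.prod_univ_sum (fun _ : Fin k => (Finset.univ : Finset ι)) (fun _ j => w j)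
  simpa [hw] using h.symm

/-- The mean of a sum of `k` independent samples is `k` times the mean of one sample. -/
lemma sum_pi_prod_weight_smul_sum {ι X : Type*} [Fintype ι] [AddCommGroup X] [Module ℝ X]
    (w : ι → ℝ) (hw : ∑ j, w j = 1) (y : ι → X) (k : ℕ) :
    ∑ f : Fin k → ι, (∏ i, w (f i)) • ∑ i, y (f i) = (k : ℝ) • ∑ j, w j • y j := by
  induction k with
  | zero => simp
  | succ k ih =>
    rw [← (Fin.consEquiv fun _ : Fin (k + 1) => ι).sum_comp, Fintype.sum_prod_type]
    have key : ∀ j : ι, ∑ g : Fin k → ι,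
        (∏ i, w (Fin.cons (α := fun _ => ι) j g i)) • ∑ i, y (Fin.cons (α := fun _ => ι) j g i)
        = w j • y j + w j • ((k : ℝ) • ∑ j, w j • y j) := by
      intro j
      simp only [Fin.prod_univ_succ, Fin.sum_univ_succ, Fin.cons_zero, Fin.cons_succ, mul_smul,
        smul_add, Finset.sum_add_distrib]
      rw [← Finset.smul_sum, ← Finset.smul_sum, ← Finset.sum_smul, sum_pi_prod_weight w hw,
        one_smul, ih]
    refine (Finset.sum_congr rfl fun j _ => key j).trans ?_
    rw [Finset.sum_add_distrib, ← Finset.sum_smul, hw, one_smul, Nat.cast_succ, add_smul,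
      one_smul, add_comm]

/-- Symmetrization: for independent samples `f`, `g` with weight `w`, the distribution of
`f - g` is unchanged by coordinatewise sign changes. -/
lemma sum_prod_weight_sign_smul_sub {ι X : Type*} [Fintype ι] [NormedAddCommGroup X]
    [NormedSpace ℝ X] (w : ι → ℝ) (y : ι → X) (k : ℕ) (φ : X → ℝ) (θ : Fin k → Bool) :
    ∑ h : Fin k → ι × ι, (∏ i, w (h i).1 * w (h i).2) *
        φ (∑ i, (if θ i then (1 : ℝ) else -1) • (y (h i).1 - y (h i).2))
      = ∑ h : Fin k → ι × ι, (∏ i, w (h i).1 * w (h i).2) *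
        φ (∑ i, (y (h i).1 - y (h i).2)) := by
  let e : (Fin k → ι × ι) ≃ (Fin k → ι × ι) :=
    Equiv.piCongrRight fun i => if θ i then Equiv.refl _ else Equiv.prodComm ι ι
  rw [← e.sum_comp (fun h => (∏ i, w (h i).1 * w (h i).2) * φ (∑ i, (y (h i).1 - y (h i).2)))]
  refine Finset.sum_congr rfl fun h _ => ?_
  congr 1
  · refine Finset.prod_congr rfl fun i _ => ?_
    cases hi : θ i <;> simp [e, hi, mul_comm]
  · congr 1
    refine Finset.sum_congr rfl fun i _ => ?_
    cases hi : θ i <;> simp [e, hi]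

/-- The expected `p`-th power of the norm of a sum of `k` independent symmetrized samples from
the unit ball of a space of type `p`. -/
lemma HasTypeLe.sum_prod_weight_norm_sub_rpow_le {ι X : Type*} [Fintype ι] [NormedAddCommGroup X]
    [NormedSpace ℝ X] {p T : ℝ} (hp : 0 ≤ p) (hT : 0 ≤ T) (htype : HasTypeLe X p T)
    (w : ι → ℝ) (hw0 : ∀ j, 0 ≤ w j) (hw : ∑ j, w j = 1) (y : ι → X) (hy : ∀ j, ‖y j‖ ≤ 1)
    (k : ℕ) :
    ∑ h : Fin k → ι × ι, (∏ i, w (h i).1 * w (h i).2) * ‖∑ i, (y (h i).1 - y (h i).2)‖ ^ p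
      ≤ T ^ p * (k * 2 ^ p) := by
  set W : (Fin k → ι × ι) → ℝ := fun h => ∏ i, w (h i).1 * w (h i).2 with hW
  have hW0 : ∀ h, 0 ≤ W h := fun h =>
    Finset.prod_nonneg fun i _ => mul_nonneg (hw0 _) (hw0 _)
  have hW1 : ∑ h, W h = 1 := by
    refine sum_pi_prod_weight (fun q : ι × ι => w q.1 * w q.2) ?_ k
    rw [Fintype.sum_prod_type, ← Fintype.sum_mul_sum, hw, one_mul]
  have hpoint : ∀ h : Fin k → ι × ι,
      (∑ θ : Fin k → Bool,
        ‖∑ i, (if θ i then (1 : ℝ) else -1) • (y (h i).1 - y (h i).2)‖ ^ p) / 2 ^ k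
        ≤ T ^ p * (k * 2 ^ p) := by
    intro h
    refine (htype k fun i => y (h i).1 - y (h i).2).trans ?_
    have hsum : ∑ i, ‖y (h i).1 - y (h i).2‖ ^ p ≤ ∑ _i : Fin k, (2 : ℝ) ^ p := by
      refine Finset.sum_le_sum fun i _ => Real.rpow_le_rpow (norm_nonneg _) ?_ hp
      linarith [norm_sub_le (y (h i).1) (y (h i).2), hy (h i).1, hy (h i).2]
    simp only [Finset.sum_const, Finset.card_univ, Fintype.card_fin, nsmul_eq_mul] at hsum
    exact mul_le_mul_of_nonneg_left hsum (Real.rpow_nonneg hT p)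
  calc ∑ h, W h * ‖∑ i, (y (h i).1 - y (h i).2)‖ ^ p
      = (∑ θ : Fin k → Bool, ∑ h, W h *
          ‖∑ i, (if θ i then (1 : ℝ) else -1) • (y (h i).1 - y (h i).2)‖ ^ p) / 2 ^ k := by
        rw [Finset.sum_congr rfl fun θ _ =>
          sum_prod_weight_sign_smul_sub w y k (fun z => ‖z‖ ^ p) θ]
        simp [hW]
    _ = ∑ h, W h * ((∑ θ : Fin k → Bool,
          ‖∑ i, (if θ i then (1 : ℝ) else -1) • (y (h i).1 - y (h i).2)‖ ^ p) / 2 ^ k) := by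
        rw [Finset.sum_comm, Finset.sum_div]
        refine Finset.sum_congr rfl fun h _ => ?_
        rw [← Finset.mul_sum, mul_div_assoc]
    _ ≤ ∑ h, W h * (T ^ p * (k * 2 ^ p)) :=
        Finset.sum_le_sum fun h _ => mul_le_mul_of_nonneg_left (hpoint h) (hW0 h)
    _ = T ^ p * (k * 2 ^ p) := by rw [← Finset.sum_mul, hW1, one_mul]

/-- Maurey's empirical method: in a space of type `p`, a convex combination of points of the unit
ball is approximated by an average of `k` of these points. -/
theorem HasTypeLe.exists_norm_sum_sub_le {ι X : Type*} [Fintype ι] [NormedAddCommGroup X]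
    [NormedSpace ℝ X] {p T : ℝ} (hp : 1 ≤ p) (hT : 0 ≤ T) (htype : HasTypeLe X p T)
    (w : ι → ℝ) (hw0 : ∀ j, 0 ≤ w j) (hw : ∑ j, w j = 1) (y : ι → X) (hy : ∀ j, ‖y j‖ ≤ 1)
    (k : ℕ) :
    ∃ f : Fin k → ι, ‖∑ i, y (f i) - (k : ℝ) • ∑ j, w j • y j‖ ≤ 2 * T * (k : ℝ) ^ (1 / p) := by
  have hp0 : 0 < p := by linarith
  set m : X := (k : ℝ) • ∑ j, w j • y j with hm
  set W : (Fin k → ι) → ℝ := fun f => ∏ i, w (f i) with hW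
  have hW0 : ∀ f, 0 ≤ W f := fun f => Finset.prod_nonneg fun i _ => hw0 _
  have hW1 : ∑ f, W f = 1 := sum_pi_prod_weight w hw k
  have hconv : ConvexOn ℝ Set.univ fun z : X => ‖z‖ ^ p := by
    refine ⟨convex_univ, fun a _ b _ s t hs ht hst => ?_⟩
    refine (Real.rpow_le_rpow (norm_nonneg _)
      (convexOn_univ_norm.2 trivial trivial hs ht hst) hp0.le).trans ?_
    exact (convexOn_rpow hp).2 (norm_nonneg a) (norm_nonneg b) hs ht hst
  have hjensen : ∀ f : Fin k → ι, ‖∑ i, y (f i) - m‖ ^ p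
      ≤ ∑ g, W g * ‖∑ i, (y (f i) - y (g i))‖ ^ p := by
    intro f
    have h := hconv.map_sum_le (t := Finset.univ) (w := W)
      (p := fun g : Fin k → ι => ∑ i, (y (f i) - y (g i))) (fun g _ => hW0 g) hW1
      (fun _ _ => Set.mem_univ _)
    have he : ∑ g, W g • ∑ i, (y (f i) - y (g i)) = ∑ i, y (f i) - m := by
      simp only [Finset.sum_sub_distrib, smul_sub]
      rw [← Finset.sum_smul, hW1, one_smul, hm, ← sum_pi_prod_weight_smul_sum w hw y k]
    simpa only [he, smul_eq_mul] using h
  have hmean : ∑ f, W f * ‖∑ i, y (f i) - m‖ ^ p ≤ ∑ f, W f * (T ^ p * (k * 2 ^ p)) := by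
    rw [← Finset.sum_mul, hW1, one_mul]
    refine le_trans ?_ (htype.sum_prod_weight_norm_sub_rpow_le hp0.le hT w hw0 hw y hy k)
    rw [← (Equiv.arrowProdEquivProdArrow (Fin k) (fun _ => ι) (fun _ => ι)).symm.sum_comp,
      Fintype.sum_prod_type]
    refine Finset.sum_le_sum fun f _ =>
      (mul_le_mul_of_nonneg_left (hjensen f) (hW0 f)).trans_eq ?_
    rw [Finset.mul_sum]
    refine Finset.sum_congr rfl fun g _ => ?_
    simp [hW, Equiv.arrowProdEquivProdArrow, Finset.prod_mul_distrib, mul_assoc]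
  obtain ⟨f, hf⟩ : ∃ f : Fin k → ι, ‖∑ i, y (f i) - m‖ ^ p ≤ T ^ p * (k * 2 ^ p) := by
    by_contra! hcon
    obtain ⟨f, -, hf⟩ : ∃ f ∈ Finset.univ, 0 < W f :=
      Finset.exists_lt_of_sum_lt (by simp [hW1])
    exact hmean.not_gt (Finset.sum_lt_sum
      (fun g _ => mul_le_mul_of_nonneg_left (hcon g).le (hW0 g))
      ⟨f, Finset.mem_univ f, mul_lt_mul_of_pos_left (hcon f) hf⟩)
  refine ⟨f, (Real.rpow_le_rpow_iff (norm_nonneg _) (by positivity) hp0).1 (hf.trans_eq ?_)⟩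
  rw [Real.mul_rpow (by positivity) (by positivity), Real.mul_rpow (by norm_num) hT,
    ← Real.rpow_mul (Nat.cast_nonneg k), one_div_mul_cancel hp0.ne', Real.rpow_one]
  ring

/-- A finite combination of elements of `D` with `ℓ¹`-norm of coefficients at most `c` is `c` times
a convex combination of elements of `D ∪ -D`. -/
lemma exists_signed_convex_combination {X : Type*} [AddCommGroup X] [Module ℝ X] {D : Set X}
    (hne : D.Nonempty) {c : ℝ} (hc : 0 < c) {n : ℕ} (a : Fin n → ℝ) (v : Fin n → X)
    (hv : ∀ i, v i ∈ D) (ha : ∑ i, |a i| ≤ c) :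
    ∃ (w σ : Fin n ⊕ Bool → ℝ) (u : Fin n ⊕ Bool → X), (∀ j, 0 ≤ w j) ∧ ∑ j, w j = 1 ∧
      (∀ j, σ j = 1 ∨ σ j = -1) ∧ (∀ j, u j ∈ D) ∧
      c • ∑ j, w j • σ j • u j = ∑ i, a i • v i := by
  obtain ⟨d, hd⟩ := hne
  refine ⟨Sum.elim (fun i => |a i| / c) fun _ => (1 - (∑ i, |a i|) / c) / 2,
    Sum.elim (fun i => if 0 ≤ a i then 1 else -1) fun b => if b then 1 else -1,
    Sum.elim v fun _ => d, ?_, ?_, ?_, ?_, ?_⟩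
  · rintro (i | b)
    · exact div_nonneg (abs_nonneg _) hc.le
    · have : (∑ i, |a i|) / c ≤ 1 := (div_le_one hc).2 ha
      simp only [Sum.elim_inr]
      linarith
  · simp only [Fintype.sum_sum_type, Sum.elim_inl, Sum.elim_inr, Fintype.sum_bool,
      ← Finset.sum_div]
    ring
  · rintro (i | b) <;> simp only [Sum.elim_inl, Sum.elim_inr] <;> split_ifs <;> simp
  · rintro (i | b)
    exacts [hv i, hd]
  · simp only [Fintype.sum_sum_type, Sum.elim_inl, Sum.elim_inr, Fintype.sum_bool]
    simp only [if_true, Bool.false_eq_true, if_false, one_smul, neg_smul, smul_neg,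
      add_neg_cancel, add_zero, Finset.smul_sum, smul_smul]
    refine Finset.sum_congr rfl fun i _ => ?_
    congr 1
    rw [← mul_assoc, mul_div_cancel₀ _ hc.ne']
    split_ifs with h
    · rw [abs_of_nonneg h, mul_one]
    · rw [abs_of_neg (not_le.1 h)]
      ring

/-- If `X` has type `p > 1` with constant at most `T` and `D` is a nonempty normalized
`c`-ARS in `X`, then for every `k ≥ 1` the set
`{(c/k) ∑_{i=1}^k ±xᵢ : xᵢ ∈ D}` is an `ε`-net of the unit ball, where
`ε = 4cT k^{-1/p*}` and `1/p + 1/p* = 1` (so `1/p* = 1 - 1/p`). -/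
theorem stmt17 {X : Type*} [NormedAddCommGroup X] [NormedSpace ℝ X] [CompleteSpace X]
    (p T c : ℝ) (hp : 1 < p) (hT : 0 < T) (hc : 1 < c)
    (htype : HasTypeLe X p T)
    (D : Set X) (hne : D.Nonempty) (hD : ∀ d ∈ D, ‖d‖ = 1)
    (hARS : IsARS c D) (k : ℕ) (hk : 0 < k) :
    ∀ x : X, ‖x‖ ≤ 1 →
      ∃ (θ : Fin k → ℝ) (v : Fin k → X),
        (∀ i, θ i = 1 ∨ θ i = -1) ∧ (∀ i, v i ∈ D) ∧
        ‖x - (c / k) • ∑ i, θ i • v i‖ ≤ 4 * c * T * (k : ℝ) ^ (-(1 - 1 / p)) := by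
  intro x hx
  have hc0 : 0 < c := by linarith
  have hk0 : (0 : ℝ) < k := Nat.cast_pos.2 hk
  set δ : ℝ := 2 * c * T * (k : ℝ) ^ (-(1 - 1 / p)) with hδ
  have hδ0 : 0 < δ := by positivity
  obtain ⟨a, v, hv, hs, hx', hle⟩ := hARS x
  obtain ⟨n, hn⟩ := (hx'.tendsto_sum_nat.eventually (Metric.ball_mem_nhds x hδ0)).exists
  rw [dist_comm, dist_eq_norm, ← Fin.sum_univ_eq_sum_range (fun i => a i • v i) n] at hn
  have ha : ∑ i : Fin n, |a i| ≤ c := by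
    have h := hs.sum_le_tsum (Finset.range n) fun i _ => norm_nonneg _
    simp only [norm_smul, hD _ (hv _), mul_one, Real.norm_eq_abs] at h hle
    rw [Fin.sum_univ_eq_sum_range (fun i => |a i|) n]
    nlinarith
  obtain ⟨w, σ, u, hw0, hw, hσ, hu, hsum⟩ :=
    exists_signed_convex_combination hne hc0 (fun i : Fin n => a i) (fun i => v i)
      (fun i => hv i) ha
  have hy : ∀ j, ‖σ j • u j‖ ≤ 1 := fun j => by
    rcases hσ j with h | h <;> simp [h, hD _ (hu j)]
  obtain ⟨f, hf⟩ := htype.exists_norm_sum_sub_le hp.le hT.le w hw0 hw (fun j => σ j • u j) hy k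
  refine ⟨fun i => σ (f i), fun i => u (f i), fun i => hσ _, fun i => hu _, ?_⟩
  have happrox : ‖(∑ i : Fin n, a i • v i) - (c / k) • ∑ i, σ (f i) • u (f i)‖ ≤ δ := by
    have he : (∑ i : Fin n, a i • v i) - (c / k) • ∑ i, σ (f i) • u (f i)
        = -((c / k) • (∑ i, σ (f i) • u (f i) - (k : ℝ) • ∑ j, w j • σ j • u j)) := by
      rw [smul_sub, smul_smul, div_mul_cancel₀ _ hk0.ne', hsum, neg_sub]
    rw [he, norm_neg, norm_smul, Real.norm_of_nonneg (by positivity)]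
    refine (mul_le_mul_of_nonneg_left hf (by positivity)).trans_eq ?_
    rw [hδ, neg_sub, Real.rpow_sub hk0, Real.rpow_one]
    ring
  calc ‖x - (c / k) • ∑ i, σ (f i) • u (f i)‖
      ≤ ‖x - ∑ i : Fin n, a i • v i‖
        + ‖(∑ i : Fin n, a i • v i) - (c / k) • ∑ i, σ (f i) • u (f i)‖ :=
        norm_sub_le_norm_sub_add_norm_sub _ _ _
    _ ≤ δ + δ := add_le_add hn.le happrox
    _ = 4 * c * T * (k : ℝ) ^ (-(1 - 1 / p)) := by
      rw [hδ]
      ring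
end

section
/- (Maurey) For every p > 1, C > 0, and c ≥ 1 there exists a constant a > 0, depending only on p, C, c, with the following property: let n ≥ 2 be an integer, let X be a finite-dimensional real normed space whose dual space X* has type p* with constant at most C (where 1/p + 1/p* = 1), and suppose there is a linear map J : X → ℓ_∞^n with ‖x‖ ≤ ‖Jx‖ ≤ c‖x‖ for all x ∈ X. Then dim X ≤ a·log n. -/
open scoped BigOperators

section EmpiricalMethod

variable {ι E : Type*} [Fintype ι] [NormedAddCommGroup E] [NormedSpace ℝ E]

/-- The weights of a finite product of copies of a probability vector sum to one. -/
lemma sum_prod_weights_eq_one {w : ι → ℝ} (hw : ∑ i, w i = 1) (k : ℕ) :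
    ∑ a : Fin k → ι, ∏ j, w (a j) = 1 := by
  classical
  have h := Finset.prod_univ_sum (fun _ : Fin k => (Finset.univ : Finset ι)) (fun _ i => w i)
  rw [Fintype.piFinset_univ] at h
  rw [← h, hw, Finset.prod_const_one]

/-- Each coordinate of the product probability vector has the original marginal law. -/
lemma sum_prod_weights_smul {w : ι → ℝ} (hw : ∑ i, w i = 1) (g : ι → E) (k : ℕ) (j : Fin k) :
    ∑ a : Fin k → ι, (∏ l, w (a l)) • g (a j) = ∑ i, w i • g i := by
  obtain ⟨m, rfl⟩ : ∃ m, k = m + 1 := ⟨k - 1, by have := j.pos; omega⟩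
  rw [← (Fin.insertNthEquiv (fun _ => ι) j).sum_comp, Fintype.sum_prod_type]
  refine Finset.sum_congr rfl fun i _ => ?_
  simp only [Fin.insertNthEquiv_apply, Fin.prod_univ_succAbove _ j, Fin.insertNth_apply_same,
    Fin.insertNth_apply_succAbove, mul_smul]
  rw [← Finset.smul_sum, ← Finset.sum_smul, sum_prod_weights_eq_one hw, one_smul]

lemma convexOn_norm_rpow {q : ℝ} (hq : 1 ≤ q) :
    ConvexOn ℝ Set.univ (fun x : E => ‖x‖ ^ q) := by
  refine ⟨convex_univ, fun x _ y _ s t hs ht hst => ?_⟩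
  calc ‖s • x + t • y‖ ^ q ≤ (s * ‖x‖ + t * ‖y‖) ^ q := by
        refine Real.rpow_le_rpow (norm_nonneg _) ?_ (by linarith)
        refine (norm_add_le _ _).trans_eq ?_
        rw [norm_smul, norm_smul, Real.norm_of_nonneg hs, Real.norm_of_nonneg ht]
    _ ≤ s • ‖x‖ ^ q + t • ‖y‖ ^ q :=
        (convexOn_rpow hq).2 (norm_nonneg x) (norm_nonneg y) hs ht hst

/-- Symmetrization: an independent family of differences may be given arbitrary signs. -/
lemma sum_pair_weights_signs (w : ι → ℝ) (g : ι → E) (q : ℝ) (k : ℕ) (θ : Fin k → Bool) :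
    ∑ z : Fin k → ι × ι, (∏ j, w (z j).1 * w (z j).2) *
        ‖∑ j, (if θ j then (1 : ℝ) else -1) • (g (z j).1 - g (z j).2)‖ ^ q =
      ∑ z : Fin k → ι × ι, (∏ j, w (z j).1 * w (z j).2) *
        ‖∑ j, (g (z j).1 - g (z j).2)‖ ^ q := by
  let e : (Fin k → ι × ι) ≃ (Fin k → ι × ι) :=
    Equiv.piCongrRight fun j => if θ j then Equiv.refl _ else Equiv.prodComm ι ι
  rw [← e.sum_comp]
  refine Finset.sum_congr rfl fun z _ => ?_
  have he : ∀ j, e z j = if θ j then z j else (z j).swap := fun j => by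
    cases h : θ j <;> simp [e, h]
  congr 1
  · refine Finset.prod_congr rfl fun j _ => ?_
    rw [he]
    cases θ j <;> simp [mul_comm]
  · congr 2
    refine Finset.sum_congr rfl fun j _ => ?_
    rw [he]
    cases θ j <;> simp

/-- Jensen's inequality against an independent copy. -/
lemma sum_weights_norm_sub_mean_le {w : ι → ℝ} (hw0 : ∀ i, 0 ≤ w i) (hw : ∑ i, w i = 1)
    (g : ι → E) {q : ℝ} (hq : 1 ≤ q) (k : ℕ) :
    ∑ a : Fin k → ι, (∏ j, w (a j)) * ‖∑ j, g (a j) - (k : ℝ) • ∑ i, w i • g i‖ ^ q ≤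
      ∑ z : Fin k → ι × ι, (∏ j, w (z j).1 * w (z j).2) *
        ‖∑ j, (g (z j).1 - g (z j).2)‖ ^ q := by
  rw [← (Equiv.arrowProdEquivProdArrow (Fin k) (fun _ => ι) (fun _ => ι)).symm.sum_comp,
    Fintype.sum_prod_type]
  refine Finset.sum_le_sum fun a _ => ?_
  have hmean : ∑ b : Fin k → ι, (∏ j, w (b j)) • ∑ j, (g (a j) - g (b j)) =
      ∑ j, g (a j) - (k : ℝ) • ∑ i, w i • g i := by
    simp only [Finset.sum_sub_distrib, smul_sub]
    rw [← Finset.sum_smul, sum_prod_weights_eq_one hw, one_smul]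
    simp only [Finset.smul_sum (s := (Finset.univ : Finset (Fin k)))]
    rw [Finset.sum_comm]
    simp only [sum_prod_weights_smul hw, Finset.sum_const, Finset.card_univ, Fintype.card_fin,
      Nat.cast_smul_eq_nsmul]
  have hJ := (convexOn_norm_rpow (E := E) hq).map_sum_le (t := Finset.univ)
    (w := fun b : Fin k → ι => ∏ j, w (b j)) (p := fun b => ∑ j, (g (a j) - g (b j)))
    (fun b _ => Finset.prod_nonneg fun j _ => hw0 _) (sum_prod_weights_eq_one hw k)
    (fun _ _ => Set.mem_univ _)
  rw [hmean] at hJ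
  refine (mul_le_mul_of_nonneg_left hJ (Finset.prod_nonneg fun j _ => hw0 (a j))).trans_eq ?_
  rw [Finset.mul_sum]
  refine Finset.sum_congr rfl fun b _ => ?_
  simp [Equiv.arrowProdEquivProdArrow, Finset.prod_mul_distrib, mul_assoc]

/-- Maurey's empirical method: in a space of type `q`, a convex combination of vectors of norm at
most `c` is approximated by an average of `k` of them. -/
lemma HasTypeLe.exists_sum_near_mean {q C c : ℝ} (hq : 1 ≤ q) (hC : 0 ≤ C)
    (hE : HasTypeLe E q C) {w : ι → ℝ} (hw0 : ∀ i, 0 ≤ w i) (hw : ∑ i, w i = 1)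
    {g : ι → E} (hg : ∀ i, ‖g i‖ ≤ c) (k : ℕ) :
    ∃ a : Fin k → ι, ‖∑ j, g (a j) - (k : ℝ) • ∑ i, w i • g i‖ ^ q ≤ (2 * c * C) ^ q * k := by
  have hι : Nonempty ι := by
    by_contra h
    rw [not_nonempty_iff] at h
    simp at hw
  have hc : 0 ≤ c := (norm_nonneg _).trans (hg hι.some)
  have hpair : ∑ z : Fin k → ι × ι, (∏ j, w (z j).1 * w (z j).2) = 1 :=
    sum_prod_weights_eq_one (w := fun x : ι × ι => w x.1 * w x.2)
      (by rw [Fintype.sum_prod_type]; simp only [← Finset.mul_sum, hw, mul_one]) k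
  have hQ0 : ∀ z : Fin k → ι × ι, 0 ≤ ∏ j, w (z j).1 * w (z j).2 := fun z =>
    Finset.prod_nonneg fun j _ => mul_nonneg (hw0 _) (hw0 _)
  have hbound : ∑ z : Fin k → ι × ι, (∏ j, w (z j).1 * w (z j).2) *
      ‖∑ j, (g (z j).1 - g (z j).2)‖ ^ q ≤ (2 * c * C) ^ q * k := by
    calc ∑ z : Fin k → ι × ι, (∏ j, w (z j).1 * w (z j).2) * ‖∑ j, (g (z j).1 - g (z j).2)‖ ^ q
        = (∑ θ : Fin k → Bool, ∑ z : Fin k → ι × ι, (∏ j, w (z j).1 * w (z j).2) *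
            ‖∑ j, (if θ j then (1 : ℝ) else -1) • (g (z j).1 - g (z j).2)‖ ^ q) / 2 ^ k := by
          simp only [sum_pair_weights_signs]
          simp
      _ = ∑ z : Fin k → ι × ι, (∏ j, w (z j).1 * w (z j).2) * ((∑ θ : Fin k → Bool,
            ‖∑ j, (if θ j then (1 : ℝ) else -1) • (g (z j).1 - g (z j).2)‖ ^ q) / 2 ^ k) := by
          rw [Finset.sum_comm, Finset.sum_div]
          simp only [← Finset.mul_sum, mul_div_assoc]
      _ ≤ ∑ z : Fin k → ι × ι, (∏ j, w (z j).1 * w (z j).2) * ((2 * c * C) ^ q * k) := by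
          refine Finset.sum_le_sum fun z _ => mul_le_mul_of_nonneg_left ?_ (hQ0 z)
          refine (hE k fun j => g (z j).1 - g (z j).2).trans ?_
          calc C ^ q * ∑ j, ‖g (z j).1 - g (z j).2‖ ^ q
              ≤ C ^ q * ∑ _j : Fin k, (2 * c) ^ q := by
                gcongr with j
                exact (norm_sub_le _ _).trans (by linarith [hg (z j).1, hg (z j).2])
            _ = (2 * c * C) ^ q * k := by
                rw [Real.mul_rpow (by positivity : 0 ≤ 2 * c) hC]
                simp only [Finset.sum_const, Finset.card_univ, Fintype.card_fin, nsmul_eq_mul]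
                ring
      _ = (2 * c * C) ^ q * k := by rw [← Finset.sum_mul, hpair, one_mul]
  by_contra! hcon
  have h := (sum_weights_norm_sub_mean_le hw0 hw g hq k).trans hbound
  have hP0 : ∀ a : Fin k → ι, 0 ≤ ∏ j, w (a j) := fun a => Finset.prod_nonneg fun j _ => hw0 _
  obtain ⟨a, -, ha⟩ : ∃ a ∈ (Finset.univ : Finset (Fin k → ι)), (0 : ℝ) < ∏ j, w (a j) := by
    refine Finset.exists_lt_of_sum_lt ?_
    rw [sum_prod_weights_eq_one hw]
    simp
  refine absurd h (not_le.2 ?_)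
  calc (2 * c * C) ^ q * k = ∑ a : Fin k → ι, (∏ j, w (a j)) * ((2 * c * C) ^ q * k) := by
        rw [← Finset.sum_mul, sum_prod_weights_eq_one hw, one_mul]
    _ < _ := Finset.sum_lt_sum
        (fun a _ => mul_le_mul_of_nonneg_left (hcon a).le (hP0 a))
        ⟨a, Finset.mem_univ _, mul_lt_mul_of_pos_left (hcon a) ha⟩

end EmpiricalMethod

/-- Volumetric bound: covering the unit ball by balls of radius `1/2` takes at least `2 ^ dim`. -/
lemma two_pow_finrank_le_card_of_cover {κ E : Type*} [Fintype κ] [NormedAddCommGroup E]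
    [NormedSpace ℝ E] [FiniteDimensional ℝ E] (y : κ → E)
    (hy : ∀ x : E, ‖x‖ ≤ 1 → ∃ s, ‖x - y s‖ ≤ 1 / 2) :
    2 ^ Module.finrank ℝ E ≤ Fintype.card κ := by
  borelize E
  let μ : MeasureTheory.Measure E := MeasureTheory.Measure.addHaar
  set d := Module.finrank ℝ E
  have hsub : Metric.closedBall (0 : E) 1 ⊆ ⋃ s, Metric.closedBall (y s) (1 / 2) := fun x hx => by
    obtain ⟨s, hs⟩ := hy x (by simpa using hx)
    exact Set.mem_iUnion.2 ⟨s, by rwa [mem_closedBall_iff_norm]⟩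
  have hpos : 0 < μ.real (Metric.closedBall (0 : E) 1) :=
    ENNReal.toReal_pos (Metric.measure_closedBall_pos μ 0 one_pos).ne'
      MeasureTheory.measure_closedBall_lt_top.ne
  have hhalf : ∀ s, μ.real (Metric.closedBall (y s) (1 / 2)) =
      (1 / 2) ^ d * μ.real (Metric.closedBall (0 : E) 1) := fun s => by
    rw [MeasureTheory.measureReal_def, MeasureTheory.Measure.addHaar_closedBall' μ _ (by norm_num),
      ENNReal.toReal_mul, ENNReal.toReal_ofReal (by positivity), MeasureTheory.measureReal_def]
  have hle : μ.real (Metric.closedBall (0 : E) 1) ≤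
      Fintype.card κ * ((1 / 2) ^ d * μ.real (Metric.closedBall (0 : E) 1)) := by
    calc μ.real (Metric.closedBall (0 : E) 1)
        ≤ μ.real (⋃ s, Metric.closedBall (y s) (1 / 2)) :=
          MeasureTheory.measureReal_mono hsub 
            (Bornology.isBounded_iUnion.2 fun s => Metric.isBounded_closedBall).measure_lt_top.ne
      _ ≤ ∑ s, μ.real (Metric.closedBall (y s) (1 / 2)) :=
          MeasureTheory.measureReal_iUnion_fintype_le _
      _ = _ := by simp only [hhalf, Finset.sum_const, Finset.card_univ, nsmul_eq_mul]
  have h1 : (1 : ℝ) ≤ Fintype.card κ * (1 / 2) ^ d := by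
    rw [← mul_assoc] at hle
    exact le_of_mul_le_mul_right (by rwa [one_mul]) hpos
  rw [one_div, inv_pow, ← div_eq_mul_inv, one_le_div (by positivity)] at h1
  exact_mod_cast h1

/-- If `‖x‖ ≤ ‖J x‖` for a map `J` into `ℓ_∞^n`, then every functional of norm at most one is a
combination of the coordinates of `J` with coefficients of total mass at most one. -/
lemma exists_coefficients_of_le_norm {n : ℕ} {X : Type*} [NormedAddCommGroup X] [NormedSpace ℝ X]
    (J : X →ₗ[ℝ] (Fin n → ℝ)) (hJ : ∀ x, ‖x‖ ≤ ‖J x‖) (φ : X →L[ℝ] ℝ) (hφ : ‖φ‖ ≤ 1) :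
    ∃ t : Fin n → ℝ, ∑ i, |t i| ≤ 1 ∧ ∀ x, φ x = ∑ i, t i * J x i := by
  have hinj : Function.Injective J := by
    rw [← LinearMap.ker_eq_bot, LinearMap.ker_eq_bot']
    intro x hx
    simpa [hx] using hJ x
  let e := LinearEquiv.ofInjective J hinj
  have hφle : ∀ x, ‖φ x‖ ≤ ‖x‖ := fun x => by
    simpa using φ.le_of_opNorm_le hφ x
  let f : StrongDual ℝ (LinearMap.range J) :=
    (φ.toLinearMap ∘ₗ e.symm.toLinearMap).mkContinuous 1 fun z => by
      obtain ⟨x, rfl⟩ := e.surjective z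
      simpa [e] using (hφle x).trans (hJ x)
  have hf : ∀ x, f (e x) = φ x := fun x => by simp [f]
  obtain ⟨ψ, hψ, hψn⟩ := exists_extension_norm_eq (LinearMap.range J) f
  have hψ1 : ‖ψ‖ ≤ 1 := hψn.trans_le (LinearMap.mkContinuous_norm_le _ zero_le_one _)
  have hrepr : ∀ v : Fin n → ℝ, ψ v = ∑ i, v i * ψ (Pi.single i 1) := fun v => by
    conv_lhs => rw [pi_eq_sum_univ' v]
    simp [map_sum]
  refine ⟨fun i => ψ (Pi.single i 1), ?_, fun x => ?_⟩
  · let v : Fin n → ℝ := fun i => SignType.sign (ψ (Pi.single i 1))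
    have hv : ‖v‖ ≤ 1 := by
      refine (pi_norm_le_iff_of_nonneg zero_le_one).2 fun i => ?_
      change ‖((SignType.sign (ψ (Pi.single i 1)) : SignType) : ℝ)‖ ≤ 1
      cases SignType.sign (ψ (Pi.single i 1)) <;> simp
    calc ∑ i, |ψ (Pi.single i 1)| = ψ v := by
          rw [hrepr]
          exact Finset.sum_congr rfl fun i _ => (sign_mul_self _).symm
      _ ≤ ‖ψ v‖ := Real.le_norm_self _
      _ ≤ 1 := by simpa using (ψ.le_of_opNorm_le_of_le hψ1 hv)
  · rw [← hf x, ← hψ (e x), hrepr]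
    exact Finset.sum_congr rfl fun i _ => mul_comm _ _

/-- A signed combination of total mass at most one is a convex combination of the vectors and
their negatives. -/
lemma exists_convex_weights {n : ℕ} (hn : n ≠ 0) {E : Type*} [AddCommGroup E] [Module ℝ E]
    (f : Fin n → E) (t : Fin n → ℝ) (ht : ∑ i, |t i| ≤ 1) :
    ∃ w : Fin n × Bool → ℝ, (∀ x, 0 ≤ w x) ∧ ∑ x, w x = 1 ∧
      ∑ x, w x • (if x.2 then f x.1 else -f x.1) = ∑ i, t i • f i := by
  let r : ℝ := (1 - ∑ i, |t i|) / n
  have hr : 0 ≤ r := div_nonneg (by linarith) (Nat.cast_nonneg n)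
  refine ⟨fun x => (|t x.1| + r + if x.2 then t x.1 else -t x.1) / 2, ?_, ?_, ?_⟩
  · rintro ⟨i, _ | _⟩
    · have := le_abs_self (t i)
      simp only [Bool.false_eq_true, if_false]
      linarith
    · have := neg_abs_le (t i)
      simp only [if_true]
      linarith
  · rw [Fintype.sum_prod_type]
    have hn' : (n : ℝ) ≠ 0 := by exact_mod_cast hn
    calc _ = ∑ i, (|t i| + r) := Finset.sum_congr rfl fun i _ => by simp; ring
      _ = 1 := by
        simp only [Finset.sum_add_distrib, Finset.sum_const, Finset.card_univ, Fintype.card_fin,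
          nsmul_eq_mul, r]
        field_simp
        ring
  · rw [Fintype.sum_prod_type]
    refine Finset.sum_congr rfl fun i _ => ?_
    simp only [Fintype.sum_bool, if_true, Bool.false_eq_true, if_false]
    module

/-- In a space of type `q > 1`, a number of samples depending only on the constants suffices. -/
lemma exists_sample_size {q : ℝ} (hq : 1 < q) (M : ℝ) :
    ∃ k : ℕ, 0 < k ∧ (2 * M) ^ q ≤ (k : ℝ) ^ (q - 1) := by
  have h := (tendsto_rpow_atTop (sub_pos.2 hq)).comp (tendsto_natCast_atTop_atTop (R := ℝ))
  obtain ⟨k, hk, hk0⟩ :=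
    ((h.eventually_ge_atTop ((2 * M) ^ q)).and (Filter.eventually_gt_atTop 0)).exists
  exact ⟨k, hk0, hk⟩

/-- (Maurey) If the dual of a finite-dimensional normed space `X` has type
`p* = p/(p-1)` with constant at most `C`, and `X` embeds `c`-isomorphically into `ℓ_∞^n`
(`ℝ^n` with the sup norm), then `dim X ≤ a log n`, where `a` depends only on `p`, `C`, `c`. -/
theorem stmt19 (p C c : ℝ) (hp : 1 < p) (hC : 0 < C) (hc : 1 ≤ c) :
    ∃ a > (0 : ℝ),
      ∀ (n : ℕ), 2 ≤ n →
        ∀ (X : Type*) [NormedAddCommGroup X] [NormedSpace ℝ X] [FiniteDimensional ℝ X],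
          HasTypeLe (X →L[ℝ] ℝ) (p / (p - 1)) C →
            ∀ J : X →ₗ[ℝ] (Fin n → ℝ),
              (∀ x : X, ‖x‖ ≤ ‖J x‖ ∧ ‖J x‖ ≤ c * ‖x‖) →
                (Module.finrank ℝ X : ℝ) ≤ a * Real.log n := by
  have hq : 1 < p / (p - 1) := by rw [one_lt_div (by linarith)]; linarith
  set q := p / (p - 1)
  obtain ⟨k, hk0, hk⟩ := exists_sample_size hq (2 * c * C)
  have hkR : (0 : ℝ) < k := by exact_mod_cast hk0
  have hlog2 : 0 < Real.log 2 := Real.log_pos one_lt_two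
  refine ⟨2 * k / Real.log 2, by positivity, fun n hn X _ _ _ hX J hJ => ?_⟩
  let f : Fin n → (X →L[ℝ] ℝ) := fun i =>
    ((LinearMap.proj i : (Fin n → ℝ) →ₗ[ℝ] ℝ) ∘ₗ J).mkContinuous c fun x =>
      (norm_le_pi_norm (J x) i).trans (hJ x).2
  let g : Fin n × Bool → (X →L[ℝ] ℝ) := fun x => if x.2 then f x.1 else -f x.1
  have hg : ∀ x, ‖g x‖ ≤ c := fun ⟨i, b⟩ => by
    have := LinearMap.mkContinuous_norm_le
      ((LinearMap.proj i : (Fin n → ℝ) →ₗ[ℝ] ℝ) ∘ₗ J) (zero_le_one.trans hc)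
      fun x => (norm_le_pi_norm (J x) i).trans (hJ x).2
    cases b
    · simpa [g, f] using this
    · simpa [g, f] using this
  have hcard := two_pow_finrank_le_card_of_cover
    (fun s : Fin k → Fin n × Bool => (k : ℝ)⁻¹ • ∑ j, g (s j)) fun φ hφ => by
      obtain ⟨t, ht, hφt⟩ := exists_coefficients_of_le_norm J (fun x => (hJ x).1) φ hφ
      obtain ⟨w, hw0, hw, hwf⟩ := exists_convex_weights (by omega) f t ht
      obtain ⟨s, hs⟩ := hX.exists_sum_near_mean hq.le hC.le hw0 hw hg k
      have hmean : ∑ x, w x • g x = φ := by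
        refine hwf.trans (ContinuousLinearMap.ext fun x => ?_)
        rw [sum_apply, hφt x]
        rfl
      rw [hmean] at hs
      refine ⟨s, ?_⟩
      have hs' : ‖∑ j, g (s j) - (k : ℝ) • φ‖ ≤ k / 2 := by
        refine (Real.rpow_le_rpow_iff (norm_nonneg _) (by positivity) (by linarith : 0 < q)).1 ?_
        refine hs.trans ?_
        rw [Real.div_rpow hkR.le zero_le_two, le_div_iff₀ (by positivity)]
        calc (2 * c * C) ^ q * k * 2 ^ q = (2 * (2 * c * C)) ^ q * k := by
              rw [Real.mul_rpow zero_le_two (by positivity : 0 ≤ 2 * c * C)]; ring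
          _ ≤ (k : ℝ) ^ (q - 1) * k := by gcongr
          _ = (k : ℝ) ^ q := by rw [Real.rpow_sub_one hkR.ne']; field_simp
      have heq : φ - (k : ℝ)⁻¹ • ∑ j, g (s j) =
          -((k : ℝ)⁻¹ • (∑ j, g (s j) - (k : ℝ) • φ)) := by
        rw [smul_sub, inv_smul_smul₀ hkR.ne', neg_sub]
      rw [heq, norm_neg, norm_smul, norm_inv, Real.norm_of_nonneg hkR.le,
        inv_mul_le_iff₀ hkR]
      linarith
  have hdim : Module.finrank ℝ (X →L[ℝ] ℝ) = Module.finrank ℝ X := by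
    rw [← (LinearMap.toContinuousLinearMap (𝕜 := ℝ) (E := X) (F' := ℝ)).finrank_eq]
    exact Subspace.dual_finrank_eq
  rw [hdim] at hcard
  have hnR : (2 : ℝ) ≤ n := by exact_mod_cast hn
  have hcardR : (2 : ℝ) ^ Module.finrank ℝ X ≤ ((n : ℝ) * 2) ^ k := by
    simpa using (Nat.cast_le (α := ℝ)).2 hcard
  have hlog := Real.log_le_log (by positivity) hcardR
  rw [Real.log_pow, Real.log_pow, Real.log_mul (by positivity) two_ne_zero] at hlog
  have hlogn : Real.log 2 ≤ Real.log n := Real.log_le_log two_pos hnR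
  rw [div_mul_eq_mul_div, le_div_iff₀ hlog2]
  nlinarith
end
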